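/- arXiv:1205.3826 — 6 statements merged into one kernel-verified Lean document; each statement's English description precedes it below -/
import Mathlib

section
/- Let N ≥ 3, let i ∈ {2,…,N−1}, and let Γ : ℝ → ℝ be 2π-periodic, twice differentiable on (0, 2π), with Γ′(θ) > 0 for every θ ∈ (0, 2π), and with second derivative of constant sign on (0, 2π). Let I ⊆ ℝ be an interval and let Θ, Ψ : I → ℝ^{N−1} be curves whose (i−1)-th and i-th components coincide identically, whose components indexed by k ∈ {1,…,N−1}\{i−1} solve the reduced C′ᵢ dynamics on I, and which satisfy Θ(t) ∈ C′ᵢ, Ψ(t) ∈ C′ᵢ and Θ(t) ≠ Ψ(t) for every t ∈ I. Then the function t ↦ ‖Θ(t) − Ψ(t)‖_{(1)} is strictly increasing on I. -/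
open Real Filter Set Topology

noncomputable section

/-- Right-hand side of the reduced `C′ᵢ` dynamics for a component `k ∉ {i-1, i}`:
`Γ(x_k) + Σ_{j∈{1..N-1}\{k,i-1,i}} Γ(x_k-x_j) + 2Γ(x_k-x_i) - Σ_{j∈{1..N-1}\{i-1,i}} Γ(-x_j) - 2Γ(-x_i)`. -/
def redRHSi (N i : ℕ) (Γ : ℝ → ℝ) (x : ℕ → ℝ) (k : ℕ) : ℝ :=
  Γ (x k) + ∑ j ∈ Finset.Icc 1 (N - 1) \ {k, i - 1, i}, Γ (x k - x j)
    + 2 * Γ (x k - x i)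
    - ∑ j ∈ Finset.Icc 1 (N - 1) \ {i - 1, i}, Γ (-(x j)) - 2 * Γ (-(x i))

/-- Right-hand side of the reduced `C′ᵢ` dynamics for the component `i`:
`Γ(x_i) + Σ_{j∈{1..N-1}\{i-1,i}} Γ(x_i-x_j) + Γ(0) - Σ_{j∈{1..N-1}\{i-1,i}} Γ(-x_j) - 2Γ(-x_i)`. -/
def redRHSii (N i : ℕ) (Γ : ℝ → ℝ) (x : ℕ → ℝ) : ℝ :=
  Γ (x i) + ∑ j ∈ Finset.Icc 1 (N - 1) \ {i - 1, i}, Γ (x i - x j)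
    + Γ 0
    - ∑ j ∈ Finset.Icc 1 (N - 1) \ {i - 1, i}, Γ (-(x j)) - 2 * Γ (-(x i))

/-- The components of `Θ` indexed by `k ∈ {1,…,N-1} \ {i-1}` solve the reduced `C′ᵢ`
dynamics on `I`. -/
def IsSolRedi (N i : ℕ) (Γ : ℝ → ℝ) (I : Set ℝ) (Θ : ℝ → ℕ → ℝ) : Prop :=
  (∀ k ∈ Finset.Icc 1 (N - 1), k ≠ i - 1 → k ≠ i → ∀ t ∈ I,
    HasDerivAt (fun s => Θ s k) (redRHSi N i Γ (Θ t) k) t) ∧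
  (∀ t ∈ I, HasDerivAt (fun s => Θ s i) (redRHSii N i Γ (Θ t)) t)

/-- The open cone `C′ᵢ = {0 < x₁ < … < x_{i-2} < x_{i-1} = x_i < x_{i+1} < … < x_{N-1} < 2π}`. -/
def inConeRedi (N i : ℕ) (x : ℕ → ℝ) : Prop :=
  0 < x 1 ∧ (∀ k ∈ Finset.Icc 1 (N - 2), k ≠ i - 1 → x k < x (k + 1)) ∧
    x (i - 1) = x i ∧ x (N - 1) < 2 * π

/-- The 1-norm (total variation) distance between the vectors with components `a,…,b` of `x,y`. -/
def dist1 (a b : ℕ) (x y : ℕ → ℝ) : ℝ :=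
  |x a - y a| + ∑ j ∈ Finset.Icc a (b - 1), |x (j + 1) - y (j + 1) - (x j - y j)|
    + |x b - y b|

/-- Weighted circular variation with antitone weights. -/
lemma weighted_variation_of_antitone (u w s : ℕ → ℝ) (hu : u 0 = 0)
    (hs : ∀ k, |s k| ≤ 1) (hsu : ∀ k, s k * (u (k + 1) - u k) = |u (k + 1) - u k|)
    (hw : Antitone w) (m : ℕ) :
    |u m| ≤ ∑ l ∈ Finset.range m, |u (l + 1) - u l| ∧
    w m * ∑ l ∈ Finset.range m, |u (l + 1) - u l| ≤
      ∑ l ∈ Finset.range m, s l * (w (l + 1) * u (l + 1) - w l * u l) := by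
  induction m with
  | zero => simp [hu]
  | succ m ih =>
    obtain ⟨h1, h2⟩ := ih
    rw [Finset.sum_range_succ, Finset.sum_range_succ _ m]
    refine ⟨?_, ?_⟩
    · have := abs_add_le (u m) (u (m + 1) - u m)
      rw [add_sub_cancel] at this
      linarith
    · have h3 : s m * u m ≤ |u m| := by
        refine (le_abs_self _).trans ?_
        rw [abs_mul]
        exact mul_le_of_le_one_left (abs_nonneg _) (hs m)
      have h4 := hw (Nat.le_succ m)
      have h5 := mul_nonneg (sub_nonneg.2 h4) (sub_nonneg.2 (h3.trans h1))
      rw [← hsu m]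
      simp only [Nat.succ_eq_add_one] at h5
      linarith

lemma weighted_variation_of_monotone (u w s : ℕ → ℝ) (n : ℕ) (hu : u n = 0)
    (hs : ∀ k, |s k| ≤ 1) (hsu : ∀ k, s k * (u (k + 1) - u k) = |u (k + 1) - u k|)
    (hw : Monotone w) :
    w 0 * ∑ l ∈ Finset.range n, |u (l + 1) - u l| ≤
      ∑ l ∈ Finset.range n, s l * (w (l + 1) * u (l + 1) - w l * u l) := by
  -- reverse the order of the indices
  have key : ∀ k, (n - (k + 1) + 1 = n - k) ∨ (n - (k + 1) = n - k) := by omega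
  have h := (weighted_variation_of_antitone (fun k => u (n - k)) (fun k => w (n - k))
    (fun k => if n - (k + 1) = n - k then 0 else - s (n - (k + 1))) (by simpa using hu)
    (fun k => by split_ifs <;> simp [hs])
    (fun k => by
      split_ifs with h
      · simp [h]
      · have h' := (key k).resolve_right h
        have := hsu (n - (k + 1))
        rw [h'] at this
        rw [abs_sub_comm, ← this]
        ring)
    (fun a b hab => hw (by omega)) n).2
  simp only [Nat.sub_self] at h
  rw [← Finset.sum_range_reflect,
    ← Finset.sum_range_reflect (fun l => s l * (w (l + 1) * u (l + 1) - w l * u l))]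
  convert h using 2
  · refine Finset.sum_congr rfl fun k hk => ?_
    have hk := Finset.mem_range.1 hk
    rw [show n - 1 - k + 1 = n - k by omega, show n - 1 - k = n - (k + 1) by omega, abs_sub_comm]
  · rename_i k hk
    have hk := Finset.mem_range.1 hk
    rw [show n - 1 - k + 1 = n - k by omega, show n - 1 - k = n - (k + 1) by omega,
      if_neg (by omega)]
    ring

/-- The mean of `f` over the segment from `a` to `b`. -/
def segMean (f : ℝ → ℝ) (a b : ℝ) : ℝ := ∫ r in (0 : ℝ)..1, f (a + r * (b - a))

lemma segment_mem_Ioo {c d a b r : ℝ} (ha : a ∈ Ioo c d) (hb : b ∈ Ioo c d)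
    (hr : r ∈ Icc (0 : ℝ) 1) : a + r * (b - a) ∈ Ioo c d := by
  have := (convex_Ioo c d).add_smul_sub_mem ha hb hr
  simpa using this

lemma continuousOn_segment {f : ℝ → ℝ} {c d a b : ℝ} (hf : ContinuousOn f (Ioo c d))
    (ha : a ∈ Ioo c d) (hb : b ∈ Ioo c d) :
    ContinuousOn (fun r => f (a + r * (b - a))) (Icc (0 : ℝ) 1) :=
  hf.comp (by fun_prop) fun _ hr => segment_mem_Ioo ha hb hr

lemma segMean_mul_sub {F f : ℝ → ℝ} {c d a b : ℝ} (hF : ∀ x ∈ Ioo c d, HasDerivAt F (f x) x)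
    (hf : ContinuousOn f (Ioo c d)) (ha : a ∈ Ioo c d) (hb : b ∈ Ioo c d) :
    segMean f a b * (b - a) = F b - F a := by
  rw [segMean, ← intervalIntegral.integral_mul_const]
  have hc := continuousOn_segment hf ha hb
  rw [intervalIntegral.integral_eq_sub_of_hasDerivAt (f := fun r => F (a + r * (b - a)))]
  · simp
  · intro r hr
    rw [uIcc_of_le zero_le_one] at hr
    have h := hF _ (segment_mem_Ioo ha hb hr)
    have h2 : HasDerivAt (fun r : ℝ => a + r * (b - a)) (b - a) r := by
      simpa using ((hasDerivAt_id r).mul_const (b - a)).const_add a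
    exact h.comp r h2
  · refine ContinuousOn.intervalIntegrable ?_
    rw [uIcc_of_le zero_le_one]
    exact hc.mul continuousOn_const

lemma segMean_pos {f : ℝ → ℝ} {c d a b : ℝ} (hf : ContinuousOn f (Ioo c d))
    (hpos : ∀ x ∈ Ioo c d, 0 < f x) (ha : a ∈ Ioo c d) (hb : b ∈ Ioo c d) :
    0 < segMean f a b := by
  have hc := continuousOn_segment hf ha hb
  refine intervalIntegral.intervalIntegral_pos_of_pos_on ?_ ?_ zero_lt_one
  · exact ContinuousOn.intervalIntegrable (by rwa [uIcc_of_le zero_le_one])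
  · exact fun r hr => hpos _ (segment_mem_Ioo ha hb (Ioo_subset_Icc_self hr))

lemma segMean_le_segMean {f g : ℝ → ℝ} {c d a b a' b' : ℝ} (hf : ContinuousOn f (Ioo c d))
    (hg : ContinuousOn g (Ioo c d))
    (ha : a ∈ Ioo c d) (hb : b ∈ Ioo c d) (ha' : a' ∈ Ioo c d) (hb' : b' ∈ Ioo c d)
    (h : ∀ r ∈ Icc (0 : ℝ) 1, f (a + r * (b - a)) ≤ g (a' + r * (b' - a'))) :
    segMean f a b ≤ segMean g a' b' := by
  refine intervalIntegral.integral_mono_on zero_le_one ?_ ?_ h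
  · exact ContinuousOn.intervalIntegrable
      (by rw [uIcc_of_le zero_le_one]; exact continuousOn_segment hf ha hb)
  · exact ContinuousOn.intervalIntegrable
      (by rw [uIcc_of_le zero_le_one]; exact continuousOn_segment hg ha' hb')

lemma segment_le_segment {a b a' b' r : ℝ} (haa : a ≤ a') (hbb : b ≤ b')
    (hr : r ∈ Icc (0 : ℝ) 1) : a + r * (b - a) ≤ a' + r * (b' - a') := by
  nlinarith [mul_nonneg hr.1 (sub_nonneg.2 hbb), mul_nonneg (sub_nonneg.2 hr.2) (sub_nonneg.2 haa)]

lemma sum_range_add_of_periodic {f : ℕ → ℝ} {n : ℕ} (hf : ∀ k, f (k + n) = f k) (j : ℕ) :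
    ∑ l ∈ Finset.range n, f (j + l) = ∑ l ∈ Finset.range n, f l := by
  induction j with
  | zero => simp
  | succ j ih =>
    rw [← ih]
    have h := Finset.sum_range_succ' (fun l => f (j + l)) n
    rw [Finset.sum_range_succ] at h
    simp only [hf, add_zero, add_left_inj] at h
    rw [h]
    exact Finset.sum_congr rfl fun l _ => by rw [add_right_comm, add_assoc]

/-- A continuous function which at every point is minorised, with contact, by a function with
positive derivative is strictly increasing. -/
lemma strictMonoOn_of_minorant_deriv_pos {V : ℝ → ℝ} {I : Set ℝ} (hI : I.OrdConnected)
    (hV : ContinuousOn V I)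
    (h : ∀ t ∈ I, ∃ L : ℝ → ℝ, ∃ c : ℝ, 0 < c ∧ HasDerivWithinAt L c I t ∧ L t = V t ∧
      ∀ r ∈ I, L r ≤ V r) : StrictMonoOn V I := by
  have loc : ∀ x ∈ I, ∀ y ∈ I, x < y → ∃ z ∈ Ioo x y, V x < V z := by
    intro x hx y hy hxy
    obtain ⟨L, c, hc, hL, hLx, hLV⟩ := h x hx
    have hsub : Ioo x y ⊆ I := fun z hz => hI.out hx hy ⟨hz.1.le, hz.2.le⟩
    have hL' : HasDerivWithinAt L c (Ioo x y) x := hL.mono hsub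
    rw [hasDerivWithinAt_iff_tendsto_slope' (by simp)] at hL'
    have hne : (𝓝[Ioo x y] x).NeBot := by
      rw [nhdsWithin_Ioo_eq_nhdsGT hxy]; infer_instance
    obtain ⟨z, hz, hzm⟩ := ((hL'.eventually_const_lt hc).and self_mem_nhdsWithin).exists
    refine ⟨z, hzm, ?_⟩
    rw [slope_def_field, div_pos_iff_of_pos_right (sub_pos.2 hzm.1), hLx] at hz
    linarith [hLV z (hsub hzm)]
  have mono : ∀ x ∈ I, ∀ y ∈ I, x ≤ y → V x ≤ V y := by
    intro x hx y hy hxy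
    have hsub : Icc x y ⊆ I := hI.out hx hy
    have hcl : IsClosed ({z | V x ≤ V z} ∩ Icc x y) := by
      rw [inter_comm]
      exact (hV.mono hsub).preimage_isClosed_of_isClosed isClosed_Icc isClosed_Ici
    refine hcl.Icc_subset_of_forall_exists_gt (le_refl (V x)) ?_ (right_mem_Icc.2 hxy)
    rintro z ⟨hz, hzx, hzy⟩ w hw
    obtain ⟨v, hv, hvV⟩ := loc z (hsub ⟨hzx, hzy.le⟩) (min w y)
      (hsub ⟨hzx.trans (le_min (le_of_lt hw) hzy.le), min_le_right _ _⟩) (lt_min hw hzy)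
    exact ⟨v, le_trans hz hvV.le, hv.1, hv.2.le.trans (min_le_left _ _)⟩
  intro x hx y hy hxy
  obtain ⟨z, hz, hzV⟩ := loc x hx y hy hxy
  exact hzV.trans_le (mono z (hI.out hx hy ⟨hz.1.le, hz.2.le⟩) y hy hz.2.le)

/-- Each oscillator contributes positively to the growth of the circular variation of `X - Y`. -/
lemma coupling_contribution_pos {Γ Γ' : ℝ → ℝ} {N j a b : ℕ} {X Y s : ℕ → ℝ}
    (hd1 : ∀ θ ∈ Ioo (0 : ℝ) (2 * π), HasDerivAt Γ (Γ' θ) θ)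
    (hc : ContinuousOn Γ' (Ioo 0 (2 * π)))
    (hpos : ∀ θ ∈ Ioo (0 : ℝ) (2 * π), 0 < Γ' θ)
    (hmon : MonotoneOn Γ' (Ioo 0 (2 * π)) ∨ AntitoneOn Γ' (Ioo 0 (2 * π)))
    (hX : ∀ k, X (k + N) = X k + 2 * π) (hY : ∀ k, Y (k + N) = Y k + 2 * π)
    (hXm : Monotone X) (hYm : Monotone Y) (hab : a ≤ b)
    (hXa : X j < X (j + a)) (hXb : X (j + b) < X j + 2 * π)
    (hYa : Y j < Y (j + a)) (hYb : Y (j + b) < Y j + 2 * π)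
    (hout : ∀ l ≤ N, l < a ∨ b < l → X (j + l) - Y (j + l) = X j - Y j)
    (hs : ∀ k, |s k| ≤ 1)
    (hsu : ∀ k, s k * (X (k + 1) - Y (k + 1) - (X k - Y k)) =
      |X (k + 1) - Y (k + 1) - (X k - Y k)|)
    (hV : 0 < ∑ k ∈ Finset.range N, |X (k + 1) - Y (k + 1) - (X k - Y k)|) :
    0 < ∑ l ∈ Finset.range N, s (j + l) *
      (Γ (X (j + l + 1) - X j) - Γ (Y (j + l + 1) - Y j) -
        (Γ (X (j + l) - X j) - Γ (Y (j + l) - Y j))) := by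
  set c : ℕ → ℕ := fun l => max a (min l b) with hcdef
  have hcm : Monotone c := fun l m hlm => max_le_max le_rfl (min_le_min hlm le_rfl)
  have hca : ∀ l, a ≤ c l := fun l => le_max_left _ _
  have hcb : ∀ l, c l ≤ b := fun l => max_le hab (min_le_right _ _)
  have hXI : ∀ l, X (j + c l) - X j ∈ Ioo (0 : ℝ) (2 * π) := fun l => by
    have h1 : X (j + a) ≤ X (j + c l) := hXm (Nat.add_le_add_left (hca l) j)
    have h2 : X (j + c l) ≤ X (j + b) := hXm (Nat.add_le_add_left (hcb l) j)
    constructor <;> linarith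
  have hYI : ∀ l, Y (j + c l) - Y j ∈ Ioo (0 : ℝ) (2 * π) := fun l => by
    have h1 : Y (j + a) ≤ Y (j + c l) := hYm (Nat.add_le_add_left (hca l) j)
    have h2 : Y (j + c l) ≤ Y (j + b) := hYm (Nat.add_le_add_left (hcb l) j)
    constructor <;> linarith
  set u : ℕ → ℝ := fun l => X (j + l) - Y (j + l) - (X j - Y j) with hu
  set w : ℕ → ℝ := fun l => segMean Γ' (Y (j + c l) - Y j) (X (j + c l) - X j) with hw
  have hwpos : ∀ l, 0 < w l := fun l => segMean_pos hc hpos (hYI l) (hXI l)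
  have hdw : ∀ l ≤ N, Γ (X (j + l) - X j) - Γ (Y (j + l) - Y j) = w l * u l := by
    intro l hl
    by_cases hlab : l < a ∨ b < l
    · have h := hout l hl hlab
      rw [show X (j + l) - X j = Y (j + l) - Y j by linarith]
      simp [hu, h]
    · have hcl : c l = l := by simp only [hcdef]; omega
      rw [← segMean_mul_sub hd1 hc (hcl ▸ hYI l) (hcl ▸ hXI l)]
      simp only [hw, hu, hcl]
      ring
  have hdiff : ∀ l, u (l + 1) - u l =
      X (j + l + 1) - Y (j + l + 1) - (X (j + l) - Y (j + l)) := fun l => by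
    simp only [hu, ← add_assoc]; ring
  have hsu' : ∀ l, s (j + l) * (u (l + 1) - u l) = |u (l + 1) - u l| := fun l => by
    rw [hdiff]; exact hsu (j + l)
  have hVu : 0 < ∑ l ∈ Finset.range N, |u (l + 1) - u l| := by
    simp only [hdiff]
    rwa [sum_range_add_of_periodic
      (f := fun k => |X (k + 1) - Y (k + 1) - (X k - Y k)|)]
    intro k
    rw [add_right_comm, hX, hY, hX, hY]
    ring_nf
  have hu0 : u 0 = 0 := by simp [hu]
  have huN : u N = 0 := by simp only [hu, hX, hY]; ring
  have hsum : ∑ l ∈ Finset.range N, s (j + l) *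
      (Γ (X (j + l + 1) - X j) - Γ (Y (j + l + 1) - Y j) -
        (Γ (X (j + l) - X j) - Γ (Y (j + l) - Y j))) =
      ∑ l ∈ Finset.range N, s (j + l) * (w (l + 1) * u (l + 1) - w l * u l) := by
    refine Finset.sum_congr rfl fun l hl => ?_
    have hl := Finset.mem_range.1 hl
    rw [← hdw l hl.le, ← hdw (l + 1) hl, add_assoc]
  rw [hsum]
  have hseg : ∀ l m, l ≤ m → ∀ r ∈ Icc (0 : ℝ) 1,
      Y (j + c l) - Y j + r * (X (j + c l) - X j - (Y (j + c l) - Y j)) ≤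
      Y (j + c m) - Y j + r * (X (j + c m) - X j - (Y (j + c m) - Y j)) := by
    intro l m hlm r hr
    have h := hcm hlm
    exact segment_le_segment (sub_le_sub_right (hYm (by omega)) _)
      (sub_le_sub_right (hXm (by omega)) _) hr
  rcases hmon with hmon | hmon
  · refine (mul_pos (hwpos 0) hVu).trans_le
      (weighted_variation_of_monotone u w (fun l => s (j + l)) N huN (fun l => hs _) hsu' ?_)
    exact fun l m hlm => segMean_le_segMean hc hc (hYI l) (hXI l) (hYI m) (hXI m) fun r hr =>
      hmon (segment_mem_Ioo (hYI l) (hXI l) hr) (segment_mem_Ioo (hYI m) (hXI m) hr)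
        (hseg l m hlm r hr)
  · refine (mul_pos (hwpos N) hVu).trans_le
      (weighted_variation_of_antitone u w (fun l => s (j + l)) hu0 (fun l => hs _) hsu' ?_ N).2
    exact fun l m hlm => segMean_le_segMean hc hc (hYI m) (hXI m) (hYI l) (hXI l) fun r hr =>
      hmon (segment_mem_Ioo (hYI l) (hXI l) hr) (segment_mem_Ioo (hYI m) (hXI m) hr)
        (hseg l m hlm r hr)

/-- The total coupling acting on oscillator `k` among the `N` oscillators with phases `X`. -/
def totalCoupling (N : ℕ) (Γ : ℝ → ℝ) (X : ℕ → ℝ) (k : ℕ) : ℝ :=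
  ∑ j ∈ Finset.range N, Γ (X k - X j)

lemma totalCoupling_add_period {N : ℕ} {Γ : ℝ → ℝ} {X : ℕ → ℝ}
    (hper : ∀ θ : ℝ, Γ (θ + 2 * π) = Γ θ) (hX : ∀ k, X (k + N) = X k + 2 * π) (k : ℕ) :
    totalCoupling N Γ X (k + N) = totalCoupling N Γ X k := by
  refine Finset.sum_congr rfl fun j _ => ?_
  rw [hX, add_sub_right_comm, hper]

/-- The phases of a system of `N` oscillators, relative to oscillator `0`, lifted to a
quasi-periodic sequence. -/
def liftPhases (N : ℕ) (x : ℕ → ℝ) (k : ℕ) : ℝ :=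
  (if k % N = 0 then 0 else x (k % N)) + 2 * π * (k / N : ℕ)

lemma liftPhases_add_period {N : ℕ} (hN : 0 < N) (x : ℕ → ℝ) (k : ℕ) :
    liftPhases N x (k + N) = liftPhases N x k + 2 * π := by
  simp only [liftPhases, Nat.add_mod_right, Nat.add_div_right k hN]
  push_cast
  ring

lemma liftPhases_zero (N : ℕ) (x : ℕ → ℝ) : liftPhases N x 0 = 0 := by simp [liftPhases]

lemma liftPhases_of_lt {N k : ℕ} (x : ℕ → ℝ) (hk : 0 < k) (hkN : k < N) :
    liftPhases N x k = x k := by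
  simp [liftPhases, Nat.mod_eq_of_lt hkN, Nat.div_eq_of_lt hkN, hk.ne']

lemma liftPhases_self {N : ℕ} (hN : 0 < N) (x : ℕ → ℝ) : liftPhases N x N = 2 * π := by
  simpa [liftPhases_zero] using liftPhases_add_period hN x 0

lemma liftPhases_step {N i : ℕ} (hN : 3 ≤ N) (hi : 2 ≤ i) {x : ℕ → ℝ}
    (hx : inConeRedi N i x) (k : ℕ) :
    liftPhases N x k ≤ liftPhases N x (k + 1) ∧
      (k % N ≠ i - 1 → liftPhases N x k < liftPhases N x (k + 1)) := by
  obtain ⟨h1, h2, h3, h4⟩ := hx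
  induction k using Nat.strong_induction_on with
  | _ k ih =>
    by_cases hk : k < N
    · rw [Nat.mod_eq_of_lt hk]
      rcases Nat.eq_zero_or_pos k with rfl | hk0
      · rw [liftPhases_zero, liftPhases_of_lt x (by omega) (by omega)]
        exact ⟨h1.le, fun _ => h1⟩
      · rw [liftPhases_of_lt x hk0 hk]
        by_cases hkN : k + 1 = N
        · rw [hkN, liftPhases_self (by omega), show k = N - 1 by omega]
          exact ⟨h4.le, fun _ => h4⟩
        · rw [liftPhases_of_lt x (by omega) (by omega)]
          by_cases hki : k = i - 1
          · subst hki
            rw [show i - 1 + 1 = i by omega]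
            exact ⟨h3.le, fun h => absurd rfl h⟩
          · have := h2 k (Finset.mem_Icc.2 ⟨hk0, by omega⟩) hki
            exact ⟨this.le, fun _ => this⟩
    · obtain ⟨m, rfl⟩ : ∃ m, k = m + N := ⟨k - N, by omega⟩
      rw [add_right_comm, liftPhases_add_period (by omega), liftPhases_add_period (by omega),
        Nat.add_mod_right]
      simpa using ih m (by omega)

lemma liftPhases_monotone {N i : ℕ} (hN : 3 ≤ N) (hi : 2 ≤ i) {x : ℕ → ℝ}
    (hx : inConeRedi N i x) : Monotone (liftPhases N x) :=
  monotone_nat_of_le_succ fun k => (liftPhases_step hN hi hx k).1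

/-- The first and last oscillators after `j`, along the circle, which do not belong to the
cluster of `j`. -/
lemma exists_outside_cluster {N i j : ℕ} (hN : 3 ≤ N) (hi : 2 ≤ i) (hi' : i ≤ N - 1) (hj : j < N) :
    ∃ a b : ℕ, a ≤ b ∧
      (∀ x, inConeRedi N i x → liftPhases N x j < liftPhases N x (j + a) ∧
        liftPhases N x (j + b) < liftPhases N x j + 2 * π) ∧
      ∀ x y, inConeRedi N i x → inConeRedi N i y → ∀ l ≤ N, l < a ∨ b < l →
        liftPhases N x (j + l) - liftPhases N y (j + l) =
          liftPhases N x j - liftPhases N y j := by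
  have hmod : ∀ k < N, (k + N) % N = k := fun k hk => by
    rw [Nat.add_mod_right, Nat.mod_eq_of_lt hk]
  have hsync : ∀ x, inConeRedi N i x → liftPhases N x (i - 1) = liftPhases N x i := fun x hx => by
    rw [liftPhases_of_lt x (by omega) (by omega), liftPhases_of_lt x (by omega) (by omega)]
    exact hx.2.2.1
  have hends : ∀ (x y : ℕ → ℝ) (l : ℕ), l = 0 ∨ l = N →
      liftPhases N x (j + l) - liftPhases N y (j + l) =
          liftPhases N x j - liftPhases N y j := by
    rintro x y l (rfl | rfl)
    · rfl
    · rw [liftPhases_add_period (by omega), liftPhases_add_period (by omega)]; ring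
  by_cases h1 : j = i - 1
  · refine ⟨2, N - 1, by omega, fun x hx => ⟨?_, ?_⟩, fun x y hx hy l hl h => ?_⟩
    · have h := (liftPhases_step hN hi hx i).2 (by rw [Nat.mod_eq_of_lt] <;> omega)
      rw [h1, hsync x hx, show i - 1 + 2 = i + 1 by omega]
      exact h
    · have h := (liftPhases_step hN hi hx (i - 2 + N)).2 (by rw [hmod] <;> omega)
      rw [← liftPhases_add_period (by omega)]
      convert h using 2 <;> omega
    · by_cases hl1 : l = 1
      · rw [hl1, h1, hsync x hx, hsync y hy, show i - 1 + 1 = i by omega]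
      · exact hends x y l (by omega)
  by_cases h2 : j = i
  · subst h2
    have hrot : ∀ x, inConeRedi N j x → liftPhases N x (j - 1 + N) = liftPhases N x j + 2 * π :=
      fun x hx => by rw [liftPhases_add_period (by omega), hsync x hx]
    refine ⟨1, N - 2, by omega, fun x hx => ⟨?_, ?_⟩, fun x y hx hy l hl h => ?_⟩
    · exact (liftPhases_step hN hi hx j).2 (by rw [Nat.mod_eq_of_lt] <;> omega)
    · have h := (liftPhases_step hN hi hx (j - 2 + N)).2 (by rw [hmod] <;> omega)
      rw [← hrot x hx]
      convert h using 2 <;> omega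
    · by_cases hl1 : l = N - 1
      · rw [hl1, show j + (N - 1) = j - 1 + N by omega, hrot x hx, hrot y hy]
        ring
      · exact hends x y l (by omega)
  · refine ⟨1, N - 1, by omega, fun x hx => ⟨?_, ?_⟩, fun x y hx hy l hl h => ?_⟩
    · exact (liftPhases_step hN hi hx j).2 (by rw [Nat.mod_eq_of_lt] <;> omega)
    · have h := (liftPhases_step hN hi hx (j + (N - 1))).2 (by
        rcases Nat.eq_zero_or_pos j with rfl | hj0
        · rw [Nat.mod_eq_of_lt] <;> omega
        · rw [show j + (N - 1) = j - 1 + N by omega, hmod] <;> omega)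
      rw [← liftPhases_add_period (by omega)]
      convert h using 2; omega
    · exact hends x y l (by omega)

lemma dist1_eq_sum_liftPhases {N : ℕ} (hN : 2 ≤ N) (x y : ℕ → ℝ) :
    dist1 1 (N - 1) x y = ∑ k ∈ Finset.range N,
      |liftPhases N x (k + 1) - liftPhases N y (k + 1) -
        (liftPhases N x k - liftPhases N y k)| := by
  obtain ⟨n, rfl⟩ : ∃ n, N = n + 2 := ⟨N - 2, by omega⟩
  rw [Finset.sum_range_succ, Finset.sum_range_succ', liftPhases_self (by omega),
    liftPhases_self (by omega), liftPhases_zero, liftPhases_zero,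
    liftPhases_of_lt x (by omega) (by omega), liftPhases_of_lt y (by omega) (by omega),
    liftPhases_of_lt x (by omega) (by omega), liftPhases_of_lt y (by omega) (by omega)]
  have h : ∑ j ∈ Finset.Icc 1 (n + 2 - 1 - 1), |x (j + 1) - y (j + 1) - (x j - y j)| =
      ∑ k ∈ Finset.range n, |liftPhases (n + 2) x (k + 1 + 1) - liftPhases (n + 2) y (k + 1 + 1) -
        (liftPhases (n + 2) x (k + 1) - liftPhases (n + 2) y (k + 1))| := by
    rw [show Finset.Icc 1 (n + 2 - 1 - 1) = Finset.Ico 1 (n + 1) by ext; simp,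
      Finset.sum_Ico_eq_sum_range]
    refine Finset.sum_congr rfl fun k hk => ?_
    have hk := Finset.mem_range.1 hk
    rw [liftPhases_of_lt x (by omega) (by omega), liftPhases_of_lt y (by omega) (by omega),
      liftPhases_of_lt x (by omega) (by omega), liftPhases_of_lt y (by omega) (by omega),
      add_comm 1 k]
  rw [dist1, h]
  simp only [sub_zero, sub_self, zero_sub, abs_neg, zero_add, show n + 2 - 1 = n + 1 by omega]
  ring

lemma totalCoupling_liftPhases {N i : ℕ} (hi : 2 ≤ i) (hi' : i ≤ N - 1) (Γ : ℝ → ℝ)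
    {x : ℕ → ℝ} (hx : x (i - 1) = x i) (k : ℕ) :
    totalCoupling N Γ (liftPhases N x) k = Γ (liftPhases N x k) +
      (∑ j ∈ Finset.Icc 1 (N - 1) \ {i - 1, i}, Γ (liftPhases N x k - x j) +
        2 * Γ (liftPhases N x k - x i)) := by
  obtain ⟨n, rfl⟩ : ∃ n, N = n + 1 := ⟨N - 1, by omega⟩
  have hsub : ({i - 1, i} : Finset ℕ) ⊆ Finset.Icc 1 (n + 1 - 1) := by
    intro j hj
    simp only [Finset.mem_insert, Finset.mem_singleton] at hj
    rw [Finset.mem_Icc]; omega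
  have hpair : ∑ j ∈ ({i - 1, i} : Finset ℕ), Γ (liftPhases (n + 1) x k - x j) =
      2 * Γ (liftPhases (n + 1) x k - x i) := by
    rw [Finset.sum_pair (by omega), hx]; ring
  rw [totalCoupling, Finset.sum_range_succ', liftPhases_zero, sub_zero, add_comm, ← hpair,
    Finset.sum_sdiff hsub, show Finset.Icc 1 (n + 1 - 1) = Finset.Ico 1 (n + 1) by ext; simp,
    Finset.sum_Ico_eq_sum_range]
  congr 1
  refine Finset.sum_congr rfl fun j hj => ?_
  have hj := Finset.mem_range.1 hj
  rw [liftPhases_of_lt x (k := j + 1) (by omega) (by omega), add_comm 1 j]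

lemma redRHSi_eq {N i k : ℕ} (hi : 2 ≤ i) (hi' : i ≤ N - 1) (Γ : ℝ → ℝ)
    {x : ℕ → ℝ} (hx : x (i - 1) = x i) (hk : k ∈ Finset.Icc 1 (N - 1)) (hk1 : k ≠ i - 1)
    (hk2 : k ≠ i) :
    redRHSi N i Γ x k =
      totalCoupling N Γ (liftPhases N x) k - totalCoupling N Γ (liftPhases N x) 0 := by
  have hk' := Finset.mem_Icc.1 hk
  rw [totalCoupling_liftPhases hi hi' Γ hx, totalCoupling_liftPhases hi hi' Γ hx, liftPhases_zero,
    liftPhases_of_lt x (by omega) (by omega), redRHSi]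
  have hmem : k ∈ Finset.Icc 1 (N - 1) \ {i - 1, i} := by simp_all
  rw [← Finset.add_sum_erase _ (fun j => Γ (x k - x j)) hmem,
    show (Finset.Icc 1 (N - 1) \ {i - 1, i}).erase k = Finset.Icc 1 (N - 1) \ {k, i - 1, i} by
      ext; simp; tauto]
  simp only [sub_self, zero_sub]
  ring

lemma redRHSii_eq {N i : ℕ} (hi : 2 ≤ i) (hi' : i ≤ N - 1) (Γ : ℝ → ℝ)
    {x : ℕ → ℝ} (hx : x (i - 1) = x i) :
    redRHSii N i Γ x =
      totalCoupling N Γ (liftPhases N x) i - totalCoupling N Γ (liftPhases N x) 0 := by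
  rw [totalCoupling_liftPhases hi hi' Γ hx, totalCoupling_liftPhases hi hi' Γ hx, liftPhases_zero,
    liftPhases_of_lt x (by omega) (by omega), redRHSii]
  simp only [sub_self, zero_sub]
  ring

lemma IsSolRedi.hasDerivWithinAt_liftPhases {N i : ℕ} {Γ : ℝ → ℝ} {I : Set ℝ} {Θ : ℝ → ℕ → ℝ}
    (hΘ : IsSolRedi N i Γ I Θ) (hi : 2 ≤ i) (hi' : i ≤ N - 1)
    (hper : ∀ θ : ℝ, Γ (θ + 2 * π) = Γ θ)
    (hsync : ∀ t ∈ I, Θ t (i - 1) = Θ t i) {t : ℝ} (ht : t ∈ I) (k : ℕ) :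
    HasDerivWithinAt (fun r => liftPhases N (Θ r) k)
      (totalCoupling N Γ (liftPhases N (Θ t)) k - totalCoupling N Γ (liftPhases N (Θ t)) 0) I t := by
  induction k using Nat.strong_induction_on with
  | _ k ih =>
    by_cases hk : k < N
    · rcases Nat.eq_zero_or_pos k with rfl | hk0
      · simpa only [liftPhases_zero, sub_self] using hasDerivWithinAt_const t I (0 : ℝ)
      have hkm : k ∈ Finset.Icc 1 (N - 1) := Finset.mem_Icc.2 ⟨hk0, by omega⟩
      by_cases hk2 : k = i
      · subst hk2
        rw [← redRHSii_eq hi hi' Γ (hsync t ht)]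
        simpa only [liftPhases_of_lt _ hk0 hk] using (hΘ.2 t ht).hasDerivWithinAt
      by_cases hk1 : k = i - 1
      · have heq : ∀ r ∈ I, liftPhases N (Θ r) k = Θ r i := fun r hr => by
          rw [liftPhases_of_lt _ hk0 hk, hk1, hsync r hr]
        have h := (hΘ.2 t ht).hasDerivWithinAt (s := I)
        rw [redRHSii_eq hi hi' Γ (hsync t ht)] at h
        have htc : totalCoupling N Γ (liftPhases N (Θ t)) k =
            totalCoupling N Γ (liftPhases N (Θ t)) i := by
          rw [totalCoupling, totalCoupling, heq t ht, liftPhases_of_lt _ (by omega) (by omega)]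
        rw [htc]
        exact h.congr heq (heq t ht)
      · rw [← redRHSi_eq hi hi' Γ (hsync t ht) hkm hk1 hk2]
        simpa only [liftPhases_of_lt _ hk0 hk] using (hΘ.1 k hkm hk1 hk2 t ht).hasDerivWithinAt
    · obtain ⟨m, rfl⟩ : ∃ m, k = m + N := ⟨k - N, by omega⟩
      have hN : 0 < N := by omega
      simp only [liftPhases_add_period hN]
      rw [totalCoupling_add_period hper (liftPhases_add_period hN _)]
      exact (ih m (by omega)).add_const _

/-- The `1`-norm distance, linearised by the signs `s`, grows under the coupling. -/
lemma signed_coupling_variation_pos {Γ Γ' : ℝ → ℝ} {N i : ℕ} {x y s : ℕ → ℝ}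
    (hN : 3 ≤ N) (hi : 2 ≤ i) (hi' : i ≤ N - 1)
    (hper : ∀ θ : ℝ, Γ (θ + 2 * π) = Γ θ)
    (hd1 : ∀ θ ∈ Ioo (0 : ℝ) (2 * π), HasDerivAt Γ (Γ' θ) θ)
    (hc : ContinuousOn Γ' (Ioo 0 (2 * π)))
    (hpos : ∀ θ ∈ Ioo (0 : ℝ) (2 * π), 0 < Γ' θ)
    (hmon : MonotoneOn Γ' (Ioo 0 (2 * π)) ∨ AntitoneOn Γ' (Ioo 0 (2 * π)))
    (hx : inConeRedi N i x) (hy : inConeRedi N i y) (hs : ∀ k, |s k| ≤ 1)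
    (hsper : ∀ k, s (k + N) = s k)
    (hsu : ∀ k, s k * (liftPhases N x (k + 1) - liftPhases N y (k + 1) -
        (liftPhases N x k - liftPhases N y k)) =
      |liftPhases N x (k + 1) - liftPhases N y (k + 1) -
        (liftPhases N x k - liftPhases N y k)|)
    (hne : ∃ k ∈ Finset.Icc 1 (N - 1), x k ≠ y k) :
    0 < ∑ k ∈ Finset.range N, s k *
      (totalCoupling N Γ (liftPhases N x) (k + 1) - totalCoupling N Γ (liftPhases N y) (k + 1) -
        (totalCoupling N Γ (liftPhases N x) k - totalCoupling N Γ (liftPhases N y) k)) := by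
  have hN0 : 0 < N := by omega
  set X := liftPhases N x with hX
  set Y := liftPhases N y with hY
  have hXp : ∀ k, X (k + N) = X k + 2 * π := liftPhases_add_period hN0 x
  have hYp : ∀ k, Y (k + N) = Y k + 2 * π := liftPhases_add_period hN0 y
  have hV : 0 < ∑ k ∈ Finset.range N, |X (k + 1) - Y (k + 1) - (X k - Y k)| := by
    obtain ⟨k, hk, hkne⟩ := hne
    rw [Finset.mem_Icc] at hk
    have h1 : |X k - Y k| ≤ ∑ l ∈ Finset.range k, |X (l + 1) - Y (l + 1) - (X l - Y l)| := by
      refine le_trans (le_of_eq ?_) (Finset.abs_sum_le_sum_abs _ _)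
      rw [Finset.sum_range_sub (fun l => X l - Y l), hX, hY, liftPhases_zero, liftPhases_zero]
      simp
    have h2 : 0 < |X k - Y k| := by
      rw [abs_pos, hX, hY, liftPhases_of_lt x (by omega) (by omega),
        liftPhases_of_lt y (by omega) (by omega)]
      exact sub_ne_zero.2 hkne
    exact (h2.trans_le h1).trans_le (Finset.sum_le_sum_of_subset_of_nonneg
      (Finset.range_subset_range.2 (by omega)) fun _ _ _ => abs_nonneg _)
  have hswap : ∑ k ∈ Finset.range N, s k * (totalCoupling N Γ X (k + 1) -
      totalCoupling N Γ Y (k + 1) - (totalCoupling N Γ X k - totalCoupling N Γ Y k)) =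
      ∑ j ∈ Finset.range N, ∑ k ∈ Finset.range N, s k * (Γ (X (k + 1) - X j) -
        Γ (Y (k + 1) - Y j) - (Γ (X k - X j) - Γ (Y k - Y j))) := by
    rw [Finset.sum_comm]
    refine Finset.sum_congr rfl fun k _ => ?_
    simp only [totalCoupling, ← Finset.sum_sub_distrib, Finset.mul_sum]
  rw [hswap]
  refine Finset.sum_pos (fun j hj => ?_) ⟨0, Finset.mem_range.2 hN0⟩
  obtain ⟨a, b, hab, hin, hout⟩ := exists_outside_cluster hN hi hi' (Finset.mem_range.1 hj)
  rw [← sum_range_add_of_periodic (f := fun k => s k * (Γ (X (k + 1) - X j) -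
        Γ (Y (k + 1) - Y j) - (Γ (X k - X j) - Γ (Y k - Y j)))) (n := N) _ j]
  · exact coupling_contribution_pos hd1 hc hpos hmon hXp hYp
      (liftPhases_monotone hN hi hx) (liftPhases_monotone hN hi hy) hab (hin x hx).1
      (hin x hx).2 (hin y hy).1 (hin y hy).2 (hout x y hx hy) hs hsu hV
  · intro k
    rw [hsper, add_right_comm]
    simp only [hXp, hYp, add_sub_right_comm _ (2 * π), hper]

/-- Expansion of the reduced `C′ᵢ` dynamics for an increasing coupling function. -/
theorem expansion_reducedCi_of_increasing_coupling
    (N i : ℕ) (hN : 3 ≤ N) (hi : 2 ≤ i) (hi' : i ≤ N - 1) (Γ Γ' Γ'' : ℝ → ℝ)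
    (hper : ∀ θ : ℝ, Γ (θ + 2 * π) = Γ θ)
    (hd1 : ∀ θ ∈ Ioo (0 : ℝ) (2 * π), HasDerivAt Γ (Γ' θ) θ)
    (hd2 : ∀ θ ∈ Ioo (0 : ℝ) (2 * π), HasDerivAt Γ' (Γ'' θ) θ)
    (hmono : ∀ θ ∈ Ioo (0 : ℝ) (2 * π), 0 < Γ' θ)
    (hcurv : (∀ θ ∈ Ioo (0 : ℝ) (2 * π), 0 ≤ Γ'' θ) ∨
      (∀ θ ∈ Ioo (0 : ℝ) (2 * π), Γ'' θ ≤ 0))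
    (I : Set ℝ) (hI : I.OrdConnected)
    (Θ Ψ : ℝ → ℕ → ℝ)
    (hΘsync : ∀ t ∈ I, Θ t (i - 1) = Θ t i) (hΨsync : ∀ t ∈ I, Ψ t (i - 1) = Ψ t i)
    (hΘ : IsSolRedi N i Γ I Θ) (hΨ : IsSolRedi N i Γ I Ψ)
    (hΘC : ∀ t ∈ I, inConeRedi N i (Θ t)) (hΨC : ∀ t ∈ I, inConeRedi N i (Ψ t))
    (hne : ∀ t ∈ I, ∃ k ∈ Finset.Icc 1 (N - 1), Θ t k ≠ Ψ t k) :
    ∀ t₁ ∈ I, ∀ t₂ ∈ I, t₁ < t₂ →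
      dist1 1 (N - 1) (Θ t₁) (Ψ t₁) < dist1 1 (N - 1) (Θ t₂) (Ψ t₂) := by
  have hN0 : 0 < N := by omega
  have hc : ContinuousOn Γ' (Ioo 0 (2 * π)) := fun θ hθ =>
    (hd2 θ hθ).continuousAt.continuousWithinAt
  have hmon : MonotoneOn Γ' (Ioo 0 (2 * π)) ∨ AntitoneOn Γ' (Ioo 0 (2 * π)) := by
    have hd : ∀ θ ∈ interior (Ioo 0 (2 * π)),
        HasDerivWithinAt Γ' (Γ'' θ) (interior (Ioo 0 (2 * π))) θ := fun θ hθ =>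
      (hd2 θ (interior_subset hθ)).hasDerivWithinAt
    refine hcurv.imp (fun h => ?_) (fun h => ?_)
    · exact monotoneOn_of_hasDerivWithinAt_nonneg (convex_Ioo _ _) hc hd
        fun θ hθ => h θ (interior_subset hθ)
    · exact antitoneOn_of_hasDerivWithinAt_nonpos (convex_Ioo _ _) hc hd
        fun θ hθ => h θ (interior_subset hθ)
  set Δ : ℕ → ℝ → ℝ := fun k t =>
    liftPhases N (Θ t) (k + 1) - liftPhases N (Ψ t) (k + 1) -
      (liftPhases N (Θ t) k - liftPhases N (Ψ t) k) with hΔ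
  have hderiv : ∀ k, ∀ t ∈ I, HasDerivWithinAt (Δ k)
      (totalCoupling N Γ (liftPhases N (Θ t)) (k + 1) -
        totalCoupling N Γ (liftPhases N (Ψ t)) (k + 1) -
        (totalCoupling N Γ (liftPhases N (Θ t)) k -
          totalCoupling N Γ (liftPhases N (Ψ t)) k)) I t := by
    intro k t ht
    have hT := hΘ.hasDerivWithinAt_liftPhases hi hi' hper hΘsync ht
    have hP := hΨ.hasDerivWithinAt_liftPhases hi hi' hper hΨsync ht
    refine (((hT (k + 1)).fun_sub (hP (k + 1))).fun_sub ((hT k).fun_sub (hP k))).congr_deriv ?_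
    ring
  have hdist : ∀ t, dist1 1 (N - 1) (Θ t) (Ψ t) = ∑ k ∈ Finset.range N, |Δ k t| := fun t =>
    dist1_eq_sum_liftPhases (by omega) _ _
  simp only [hdist]
  suffices h : StrictMonoOn (fun t => ∑ k ∈ Finset.range N, |Δ k t|) I from
    fun t₁ h₁ t₂ h₂ h₁₂ => h h₁ h₂ h₁₂
  refine strictMonoOn_of_minorant_deriv_pos hI
    (continuousOn_finsetSum _ fun k _ => (fun t ht => (hderiv k t ht).continuousWithinAt.abs))
    fun t ht => ?_
  set s : ℕ → ℝ := fun k => (SignType.sign (Δ k t) : ℝ) with hs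
  have hs1 : ∀ k, |s k| ≤ 1 := fun k => by
    rcases lt_trichotomy (Δ k t) 0 with h | h | h <;> simp [hs, h]
  have hsΔ : ∀ k, s k * Δ k t = |Δ k t| := fun k => sign_mul_self _
  have hsper : ∀ k, s (k + N) = s k := fun k => by
    have : Δ (k + N) t = Δ k t := by
      simp only [hΔ, add_right_comm k N 1, liftPhases_add_period hN0]
      ring
    simp only [hs, this]
  refine ⟨fun r => ∑ k ∈ Finset.range N, s k * Δ k r, _,
    signed_coupling_variation_pos hN hi hi' hper hd1 hc hmono hmon (hΘC t ht) (hΨC t ht) hs1 hsper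
      hsΔ (hne t ht), HasDerivWithinAt.fun_sum fun k _ => (hderiv k t ht).const_mul (s k),
    Finset.sum_congr rfl fun k _ => hsΔ k, fun r _ => Finset.sum_le_sum fun k _ => ?_⟩
  refine (le_abs_self _).trans ?_
  rw [abs_mul]
  exact mul_le_of_le_one_left (abs_nonneg _) (hs1 k)
end
end

section
/- Let N ≥ 3 and let Γ : ℝ → ℝ be 2π-periodic, continuous and strictly decreasing on (0, 2π), and suppose Γ(θ) → L₀ as θ → 0⁺ and Γ(θ) → L_{2π} as θ → 2π⁻ for real numbers L₀, L_{2π}. Fix k ∈ {1,…,N−2} and reals 0 < a_1 < … < a_{N−1} < 2π, and for ε > 0 let θ̃(ε) ∈ ℝ^{N−1} be the point with θ̃_j = a_j for j ≠ k+1, θ̃_k = a_k and θ̃_{k+1} = a_k + ε. Then, as ε → 0⁺, the difference F_{k+1}(θ̃(ε)) − F_k(θ̃(ε)) tends to L₀ − L_{2π}, and L₀ − L_{2π} > 0. -/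
open Real Filter Set Topology

noncomputable section

/-- Right-hand side of the phase-difference dynamics on `ℝ^{N-1}` (components `1,…,N-1`). -/
def fullRHS (N : ℕ) (Γ : ℝ → ℝ) (x : ℕ → ℝ) (k : ℕ) : ℝ :=
  Γ (x k) + ∑ j ∈ (Finset.Icc 1 (N - 1)).erase k, Γ (x k - x j)
    - ∑ j ∈ Finset.Icc 1 (N - 1), Γ (-(x j))

/-- A `2π`-periodic function continuous on `(0, 2π)` is continuous at every nonzero point of
`(-2π, 2π)`. -/
theorem continuousAt_of_periodic_of_abs_lt {Γ : ℝ → ℝ} (hper : ∀ θ : ℝ, Γ (θ + 2 * π) = Γ θ)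
    (hcont : ContinuousOn Γ (Ioo (0 : ℝ) (2 * π))) {x : ℝ} (hx : x ≠ 0) (hx' : |x| < 2 * π) :
    ContinuousAt Γ x := by
  obtain ⟨h1, h2⟩ := abs_lt.mp hx'
  rcases lt_or_gt_of_ne hx with h | h
  · have hc : ContinuousAt Γ (x + 2 * π) :=
      hcont.continuousAt (Ioo_mem_nhds (by linarith) (by linarith))
    have hs : ContinuousAt (fun θ : ℝ => Γ (θ + 2 * π)) x :=
      ContinuousAt.comp (f := fun θ : ℝ => θ + 2 * π) hc (by fun_prop)
    simpa only [hper] using hs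
  · exact hcont.continuousAt (Ioo_mem_nhds h h2)

/-- A strictly decreasing function on an interval has a larger limit at the left endpoint than at
the right endpoint. -/
theorem lim_right_lt_lim_left_of_strictAntiOn {f : ℝ → ℝ} {a b A B : ℝ} (hab : a < b)
    (hf : StrictAntiOn f (Ioo a b)) (hA : Tendsto f (𝓝[>] a) (𝓝 A))
    (hB : Tendsto f (𝓝[<] b) (𝓝 B)) : B < A := by
  obtain ⟨c, hac, hcb⟩ := exists_between hab
  obtain ⟨d, hcd, hdb⟩ := exists_between hcb
  have hcA : f c ≤ A := by
    refine ge_of_tendsto hA ?_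
    filter_upwards [Ioo_mem_nhdsGT hac] with x hx
    exact (hf ⟨hx.1, hx.2.trans hcb⟩ ⟨hac, hcb⟩ hx.2).le
  have hBd : B ≤ f d := by
    refine le_of_tendsto hB ?_
    filter_upwards [Ioo_mem_nhdsLT hdb] with x hx
    exact (hf ⟨hac.trans hcd, hdb⟩ ⟨(hac.trans hcd).trans hx.1, hx.2⟩ hx.1).le
  exact hBd.trans_lt ((hf ⟨hac, hcb⟩ ⟨hac.trans hcd, hdb⟩ hcd).trans_le hcA)

/-- A sequence increasing at each step of `[m, n]` is increasing on `[m, n]`. -/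
theorem lt_of_lt_of_forall_lt_succ {a : ℕ → ℝ} {m n : ℕ}
    (h : ∀ j, m ≤ j → j < n → a j < a (j + 1)) {i j : ℕ} (hi : m ≤ i) (hij : i < j)
    (hj : j ≤ n) : a i < a j := by
  induction j, hij using Nat.le_induction with
  | base => exact h i hi hj
  | succ j hij ih => exact (ih (by omega)).trans (h j (by omega) (by omega))

/-- The difference of two components of the vector field when the `(k+1)`-st coordinate exceeds
the `k`-th by `ε`. -/
theorem fullRHS_succ_sub_fullRHS {N k : ℕ} (hk : k ∈ Finset.Icc 1 (N - 1))
    (hk' : k + 1 ∈ Finset.Icc 1 (N - 1)) (Γ : ℝ → ℝ) (a : ℕ → ℝ) (ε : ℝ) :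
    fullRHS N Γ (fun j => if j = k + 1 then a k + ε else a j) (k + 1)
        - fullRHS N Γ (fun j => if j = k + 1 then a k + ε else a j) k
      = (Γ (a k + ε) - Γ (a k))
        + ∑ j ∈ ((Finset.Icc 1 (N - 1)).erase k).erase (k + 1),
            (Γ (a k + ε - a j) - Γ (a k - a j))
        + (Γ ε - Γ (-ε)) := by
  have hne : k ≠ k + 1 := by omega
  unfold fullRHS
  rw [← Finset.add_sum_erase _ _ (Finset.mem_erase.mpr ⟨hne, hk⟩),
    ← Finset.add_sum_erase _ _ (Finset.mem_erase.mpr ⟨hne.symm, hk'⟩),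
    Finset.erase_right_comm, Finset.sum_sub_distrib]
  have hsum (c : ℝ) :
      ∑ j ∈ ((Finset.Icc 1 (N - 1)).erase k).erase (k + 1),
          Γ (c - if j = k + 1 then a k + ε else a j)
        = ∑ j ∈ ((Finset.Icc 1 (N - 1)).erase k).erase (k + 1), Γ (c - a j) :=
    Finset.sum_congr rfl fun j hj => by rw [if_neg (Finset.ne_of_mem_erase hj)]
  simp only [if_true, if_neg hne, hsum, add_sub_cancel_left, sub_add_cancel_left]
  ring

/-- Near the boundary `θ̃_k = θ̃_{k+1}` of the cone, the difference `F_{k+1} - F_k` of the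
vector field of the phase-difference dynamics tends to `L₀ - L_{2π} > 0`
(repelling boundary). -/
theorem boundary_repelling_consecutive_components
    (N : ℕ) (hN : 3 ≤ N) (Γ : ℝ → ℝ) (L₀ L₂π : ℝ)
    (hper : ∀ θ : ℝ, Γ (θ + 2 * π) = Γ θ)
    (hcont : ContinuousOn Γ (Ioo (0 : ℝ) (2 * π)))
    (hanti : StrictAntiOn Γ (Ioo (0 : ℝ) (2 * π)))
    (hlim0 : Tendsto Γ (𝓝[>] (0 : ℝ)) (𝓝 L₀))
    (hlim2π : Tendsto Γ (𝓝[<] (2 * π)) (𝓝 L₂π))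
    (k : ℕ) (hk : k ∈ Finset.Icc 1 (N - 2))
    (a : ℕ → ℝ)
    (ha : ∀ j ∈ Finset.Icc 1 (N - 1), 0 < a j ∧ a j < 2 * π)
    (ha' : ∀ j ∈ Finset.Icc 1 (N - 2), a j < a (j + 1)) :
    Tendsto (fun ε : ℝ =>
        fullRHS N Γ (fun j => if j = k + 1 then a k + ε else a j) (k + 1)
          - fullRHS N Γ (fun j => if j = k + 1 then a k + ε else a j) k)
      (𝓝[>] (0 : ℝ)) (𝓝 (L₀ - L₂π)) ∧ 0 < L₀ - L₂π := by
  have hk_bounds := Finset.mem_Icc.mp hk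
  have hkN : k ∈ Finset.Icc 1 (N - 1) := Finset.mem_Icc.mpr ⟨by omega, by omega⟩
  have hkN' : k + 1 ∈ Finset.Icc 1 (N - 1) := Finset.mem_Icc.mpr ⟨by omega, by omega⟩
  refine ⟨?_, sub_pos.mpr (lim_right_lt_lim_left_of_strictAntiOn two_pi_pos hanti hlim0 hlim2π)⟩
  have hmono : ∀ {i j : ℕ}, 1 ≤ i → i < j → j ≤ N - 1 → a i < a j :=
    lt_of_lt_of_forall_lt_succ fun j h1 h2 => ha' j (Finset.mem_Icc.mpr ⟨h1, by omega⟩)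
  have hshift {c : ℝ} (hc : c ≠ 0) (hc' : |c| < 2 * π) :
      Tendsto (fun ε : ℝ => Γ (c + ε) - Γ c) (𝓝[>] (0 : ℝ)) (𝓝 0) := by
    have hadd : Tendsto (fun ε : ℝ => c + ε) (𝓝[>] (0 : ℝ)) (𝓝 c) := by
      have h : Tendsto (fun ε : ℝ => c + ε) (𝓝 (0 : ℝ)) (𝓝 (c + 0)) :=
        Continuous.tendsto (by fun_prop) 0
      rw [add_zero] at h
      exact h.mono_left nhdsWithin_le_nhds
    simpa using
      ((continuousAt_of_periodic_of_abs_lt hper hcont hc hc').tendsto.comp hadd).sub_const (Γ c)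
  have hneg : Tendsto (fun ε : ℝ => Γ (-ε)) (𝓝[>] (0 : ℝ)) (𝓝 L₂π) := by
    have hsub : Tendsto (fun ε : ℝ => -ε + 2 * π) (𝓝[>] (0 : ℝ)) (𝓝[<] (2 * π)) := by
      refine tendsto_nhdsWithin_iff.mpr ⟨?_, ?_⟩
      · have h : Tendsto (fun ε : ℝ => -ε + 2 * π) (𝓝 (0 : ℝ)) (𝓝 (-0 + 2 * π)) :=
          Continuous.tendsto (by fun_prop) 0
        rw [neg_zero, zero_add] at h
        exact h.mono_left nhdsWithin_le_nhds
      · filter_upwards [self_mem_nhdsWithin] with ε hε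
        have hε' : 0 < ε := hε
        exact mem_Iio.mpr (by linarith)
    simpa only [Function.comp_def, hper] using hlim2π.comp hsub
  have hak := ha k hkN
  have hsum : Tendsto (fun ε : ℝ => ∑ j ∈ ((Finset.Icc 1 (N - 1)).erase k).erase (k + 1),
      (Γ (a k + ε - a j) - Γ (a k - a j))) (𝓝[>] (0 : ℝ)) (𝓝 0) := by
    have hzero := Finset.sum_const_zero (M := ℝ)
      (s := ((Finset.Icc 1 (N - 1)).erase k).erase (k + 1))
    refine (tendsto_finsetSum _ fun j hj => ?_).trans (congrArg 𝓝 hzero).le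
    obtain ⟨-, hjk, hjN⟩ : j ≠ k + 1 ∧ j ≠ k ∧ j ∈ Finset.Icc 1 (N - 1) := by
      simpa only [Finset.mem_erase] using hj
    have hj_bounds := Finset.mem_Icc.mp hjN
    have haj := ha j hjN
    have hne : a k - a j ≠ 0 := by
      rcases lt_or_gt_of_ne hjk with h | h
      · exact (sub_pos.mpr (hmono hj_bounds.1 h (by omega))).ne'
      · exact (sub_neg.mpr (hmono hk_bounds.1 h hj_bounds.2)).ne
    simpa only [sub_add_eq_add_sub] using
      hshift hne (abs_lt.mpr ⟨by linarith, by linarith⟩)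
  have hfirst := hshift hak.1.ne' (abs_lt.mpr ⟨by linarith, by linarith⟩)
  simp only [fullRHS_succ_sub_fullRHS hkN hkN']
  simpa only [zero_add] using (hfirst.add hsum).add (hlim0.sub hneg)
end
end

section
/- Let N ≥ 2 and let Γ : ℝ → ℝ be 2π-periodic, continuous and strictly decreasing on (0, 2π), with finite one-sided limits L₀ = lim_{θ→0⁺} Γ(θ) and L_{2π} = lim_{θ→2π⁻} Γ(θ). Let T > 0 and let Θ : [0, T] → ℝ^{N−1} be continuous, solve the phase-difference dynamics on [0, T), and satisfy Θ(t) ∈ C for every t ∈ [0, T). Then Θ(T) ∈ C; that is, an orbit starting in the open cone C cannot reach the boundary of C. -/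
open Real Filter Set Topology

noncomputable section

/-- `Θ` is a solution of the phase-difference dynamics on `I`. -/
def IsSolFull (N : ℕ) (Γ : ℝ → ℝ) (I : Set ℝ) (Θ : ℝ → ℕ → ℝ) : Prop :=
  ∀ k ∈ Finset.Icc 1 (N - 1), ∀ t ∈ I,
    HasDerivAt (fun s => Θ s k) (fullRHS N Γ (Θ t) k) t

/-- The open cone `C = {0 < x₁ < x₂ < … < x_{N-1} < 2π}`. -/
def inCone (N : ℕ) (x : ℕ → ℝ) : Prop :=
  0 < x 1 ∧ (∀ k ∈ Finset.Icc 1 (N - 2), x k < x (k + 1)) ∧ x (N - 1) < 2 * π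

/-- A continuous function that is positive on `[0, T)` and increases wherever it is small
is still positive at time `T`. -/
theorem pos_of_deriv_pos_of_small {T ε : ℝ} (hT : 0 < T) (hε : 0 < ε) {g g' : ℝ → ℝ}
    (hcont : ContinuousOn g (Icc 0 T)) (hderiv : ∀ t ∈ Ico 0 T, HasDerivAt g (g' t) t)
    (hpos : ∀ t ∈ Ico 0 T, 0 < g t) (hsmall : ∀ t ∈ Ico 0 T, g t < ε → 0 < g' t) :
    0 < g T := by
  by_contra! hgT
  have hev : ∀ᶠ t in 𝓝[Icc 0 T] T, g t < ε :=
    (hcont T ⟨hT.le, le_rfl⟩).eventually (gt_mem_nhds (hgT.trans_lt hε))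
  obtain ⟨δ, hδ, hball⟩ := Metric.mem_nhdsWithin_iff.1 hev
  obtain ⟨s, hs, hsT⟩ := exists_between (max_lt hT (sub_lt_self T hδ))
  have hs0 : 0 < s := (le_max_left _ _).trans_lt hs
  have hsδ : T - δ < s := (le_max_right _ _).trans_lt hs
  have hmono : StrictMonoOn g (Icc s T) := by
    refine strictMonoOn_of_deriv_pos (convex_Icc s T)
      (hcont.mono (Icc_subset_Icc_left hs0.le)) fun t ht => ?_
    rw [interior_Icc] at ht
    have ht' : t ∈ Ico 0 T := ⟨hs0.le.trans ht.1.le, ht.2⟩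
    rw [(hderiv t ht').deriv]
    refine hsmall t ht' (hball ⟨?_, ht'.1, ht.2.le⟩)
    rw [Metric.mem_ball, Real.dist_eq, abs_lt]
    constructor <;> linarith [ht.1, ht.2]
  have := hmono ⟨le_rfl, hsT.le⟩ ⟨hsT.le, le_rfl⟩ hsT
  linarith [hpos s ⟨hs0.le, hsT⟩]

/-- The total coupling felt by oscillator `k` among the oscillators in `S` with phases `p`. -/
def coupling (Γ : ℝ → ℝ) (S : Finset ℕ) (p : ℕ → ℝ) (k : ℕ) : ℝ :=
  ∑ j ∈ S.erase k, Γ (p k - p j)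

/-- Two phases that are close together are driven apart, provided no third phase lies between
them on the circle. -/
theorem exists_gap_coupling_lt {Γ : ℝ → ℝ} {L₀ L₂π : ℝ}
    (hcont : ContinuousOn Γ (Ioo (0 : ℝ) (2 * π)))
    (hanti : StrictAntiOn Γ (Ioo (0 : ℝ) (2 * π)))
    (hlim0 : Tendsto Γ (𝓝[>] (0 : ℝ)) (𝓝 L₀))
    (hlim2π : Tendsto Γ (𝓝[<] (2 * π)) (𝓝 L₂π)) (S : Finset ℕ) :
    ∃ ε > 0, ∀ (p : ℕ → ℝ) (a b : ℕ) (g : ℝ), a ∈ S → b ∈ S → a ≠ b → 0 < g → g < ε →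
      Γ (p b - p a) = Γ g → Γ (p a - p b) = Γ (2 * π - g) →
      (∀ j ∈ S, j ≠ a → j ≠ b → ∃ u ∈ Ioo 0 (2 * π), u + g ∈ Ioo 0 (2 * π) ∧
        Γ (p a - p j) = Γ u ∧ Γ (p b - p j) = Γ (u + g)) →
      coupling Γ S p a < coupling Γ S p b := by
  have hπ := pi_gt_three
  have hext : ContinuousOn (extendFrom (Ioo 0 (2 * π)) Γ) (Icc 0 (2 * π)) :=
    continuousOn_Icc_extendFrom_Ioo hcont hlim0 hlim2π
  have hunif := isCompact_Icc.uniformContinuousOn_of_continuous hext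
  have hextEq : ∀ u ∈ Ioo 0 (2 * π), extendFrom (Ioo 0 (2 * π)) Γ u = Γ u := fun u hu =>
    extendFrom_eq (subset_closure hu) (hcont u hu)
  have hc : 0 < Γ 2 - Γ 4 :=
    sub_pos.2 (hanti ⟨by norm_num, by linarith⟩ ⟨by norm_num, by linarith⟩ (by norm_num))
  have hη : 0 < (Γ 2 - Γ 4) / (S.card + 1) := by positivity
  obtain ⟨δ, hδ, hclose⟩ := Metric.uniformContinuousOn_iff.1 hunif _ hη
  refine ⟨min 2 δ, lt_min two_pos hδ, fun p a b g ha hb hab hg hgε hba hab' hj => ?_⟩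
  have hg2 : g < 2 := hgε.trans_le (min_le_left _ _)
  have hgδ : g < δ := hgε.trans_le (min_le_right _ _)
  have hpair : Γ 2 - Γ 4 < Γ g - Γ (2 * π - g) :=
    sub_lt_sub (hanti ⟨hg, by linarith⟩ ⟨by norm_num, by linarith⟩ hg2)
      (hanti ⟨by norm_num, by linarith⟩ ⟨by linarith, by linarith⟩ (by linarith))
  have hterm : ∀ j ∈ (S.erase a).erase b,
      -((Γ 2 - Γ 4) / (S.card + 1)) ≤ Γ (p b - p j) - Γ (p a - p j) := by
    intro j hjS
    simp only [Finset.mem_erase] at hjS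
    obtain ⟨u, hu, hv, hau, hbv⟩ := hj j hjS.2.2 hjS.2.1 hjS.1
    have := hclose (u + g) (Ioo_subset_Icc_self hv) u (Ioo_subset_Icc_self hu)
      (by rwa [Real.dist_eq, add_sub_cancel_left, abs_of_pos hg])
    rw [hextEq _ hv, hextEq _ hu, Real.dist_eq] at this
    rw [hau, hbv]
    exact (abs_lt.1 this).1.le
  have hsum := Finset.card_nsmul_le_sum _ _ _ hterm
  rw [Finset.sum_sub_distrib, nsmul_eq_mul] at hsum
  have hcard : (((S.erase a).erase b).card : ℝ) ≤ S.card + 1 := by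
    have : ((S.erase a).erase b).card ≤ S.card :=
      Finset.card_le_card ((Finset.erase_subset _ _).trans (Finset.erase_subset _ _))
    exact_mod_cast this.trans (Nat.le_succ _)
  have hbound : (((S.erase a).erase b).card : ℝ) * ((Γ 2 - Γ 4) / (S.card + 1)) ≤ Γ 2 - Γ 4 :=
    (mul_le_mul_of_nonneg_right hcard hη.le).trans_eq (mul_div_cancel₀ _ (by positivity))
  have hA : coupling Γ S p a = Γ (2 * π - g) + ∑ j ∈ (S.erase a).erase b, Γ (p a - p j) := by
    rw [coupling, ← Finset.add_sum_erase _ _ (Finset.mem_erase.2 ⟨hab.symm, hb⟩), hab']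
  have hB : coupling Γ S p b = Γ g + ∑ j ∈ (S.erase a).erase b, Γ (p b - p j) := by
    rw [coupling, ← Finset.add_sum_erase _ _ (Finset.mem_erase.2 ⟨hab, ha⟩), hba,
      Finset.erase_right_comm]
  linarith

/-- The dynamics in terms of all `N` phases, the reference oscillator `0` having phase `0`. -/
theorem fullRHS_eq_coupling_sub {N : ℕ} (hN : 2 ≤ N) (Γ : ℝ → ℝ) (x : ℕ → ℝ) {k : ℕ}
    (hk : k ∈ Finset.Icc 1 (N - 1)) :
    fullRHS N Γ x k = coupling Γ (Finset.range N) (Function.update x 0 0) k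
      - coupling Γ (Finset.range N) (Function.update x 0 0) 0 := by
  have hk0 : k ≠ 0 := by grind
  have hrange : (Finset.range N).erase 0 = Finset.Icc 1 (N - 1) := by
    ext j; simp only [Finset.mem_erase, Finset.mem_range, Finset.mem_Icc]; omega
  have hupd : ∀ j ∈ Finset.Icc 1 (N - 1), Function.update x 0 0 j = x j := fun j hj =>
    Function.update_of_ne (by grind) _ _
  rw [fullRHS, coupling, coupling, hrange,
    ← Finset.add_sum_erase ((Finset.range N).erase k) _ (a := 0) (by grind),
    Finset.erase_right_comm, hrange, Function.update_self, sub_zero, hupd k hk]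
  congr 1
  · congr 1
    exact Finset.sum_congr rfl fun j hj => by rw [hupd j (Finset.mem_of_mem_erase hj)]
  · exact Finset.sum_congr rfl fun j hj => by rw [hupd j hj, zero_sub]

theorem inCone.strictMonoOn {N : ℕ} {x : ℕ → ℝ} (hx : inCone N x) :
    StrictMonoOn (Function.update x 0 0) (Iic (N - 1)) := by
  refine strictMonoOn_of_lt_add_one ordConnected_Iic fun k _ _ hk => ?_
  rw [mem_Iic] at hk
  rw [Function.update_of_ne (by omega : k + 1 ≠ 0)]
  rcases Nat.eq_zero_or_pos k with rfl | hk0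
  · simpa using hx.1
  · rw [Function.update_of_ne hk0.ne']
    exact hx.2.1 k (by grind)

theorem inCone.mem_Ico {N : ℕ} (hN : 2 ≤ N) {x : ℕ → ℝ} (hx : inCone N x) {k : ℕ}
    (hk : k < N) : Function.update x 0 0 k ∈ Ico 0 (2 * π) := by
  constructor
  · simpa using hx.strictMonoOn.monotoneOn (mem_Iic.2 (Nat.zero_le _))
      (mem_Iic.2 (by omega)) (Nat.zero_le k)
  · refine (hx.strictMonoOn.monotoneOn (mem_Iic.2 (by omega)) (mem_Iic.2 le_rfl)
      (by omega : k ≤ N - 1)).trans_lt ?_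
    rw [Function.update_of_ne (by omega)]
    exact hx.2.2

/-- In the cone, every gap between cyclically consecutive phases grows when it is small. -/
theorem exists_small_gap_coupling_lt {N : ℕ} (hN : 2 ≤ N) {Γ : ℝ → ℝ} {L₀ L₂π : ℝ}
    (hper : ∀ θ : ℝ, Γ (θ + 2 * π) = Γ θ)
    (hcont : ContinuousOn Γ (Ioo (0 : ℝ) (2 * π)))
    (hanti : StrictAntiOn Γ (Ioo (0 : ℝ) (2 * π)))
    (hlim0 : Tendsto Γ (𝓝[>] (0 : ℝ)) (𝓝 L₀))
    (hlim2π : Tendsto Γ (𝓝[<] (2 * π)) (𝓝 L₂π)) :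
    ∃ ε > 0, ∀ x : ℕ → ℝ, inCone N x →
      (∀ k, k + 1 < N → Function.update x 0 0 (k + 1) - Function.update x 0 0 k < ε →
        coupling Γ (Finset.range N) (Function.update x 0 0) k <
          coupling Γ (Finset.range N) (Function.update x 0 0) (k + 1)) ∧
      (2 * π - x (N - 1) < ε →
        coupling Γ (Finset.range N) (Function.update x 0 0) (N - 1) <
          coupling Γ (Finset.range N) (Function.update x 0 0) 0) := by
  obtain ⟨ε, hε, h⟩ :=
    exists_gap_coupling_lt hcont hanti hlim0 hlim2π (Finset.range N)
  refine ⟨ε, hε, fun x hx => ?_⟩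
  have hlast : Function.update x 0 0 (N - 1) = x (N - 1) :=
    Function.update_of_ne (by omega) _ _
  have hzero : Function.update x 0 0 0 = 0 := Function.update_self ..
  have hmono : ∀ i j, i < j → j < N → Function.update x 0 0 i < Function.update x 0 0 j :=
    fun i j hij hj => hx.strictMonoOn (mem_Iic.2 (by omega)) (mem_Iic.2 (by omega)) hij
  have hmem : ∀ k < N, Function.update x 0 0 k ∈ Ico 0 (2 * π) := fun k hk => hx.mem_Ico hN hk
  generalize Function.update x 0 0 = p at *
  constructor
  · intro k hk hgap
    refine h p k (k + 1) (p (k + 1) - p k) (by grind) (by grind) (by omega)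
      (sub_pos.2 (hmono _ _ k.lt_succ_self hk)) hgap rfl
      (by rw [← hper (p k - p (k + 1))]; congr 1; ring) fun j hj hja hjb => ?_
    have hj := Finset.mem_range.1 hj
    have hjI := hmem j hj
    have hkI := hmem k (by omega)
    have hkI' := hmem (k + 1) hk
    have hkk := hmono k (k + 1) k.lt_succ_self hk
    rcases lt_or_gt_of_ne hja with hlt | hgt
    · have := hmono j k hlt (by omega)
      refine ⟨p k - p j, ⟨by linarith, by linarith [hkI.2, hjI.1]⟩,
        ⟨by linarith, by linarith [hkI'.2, hjI.1]⟩, rfl, by congr 1; ring⟩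
    · have := hmono (k + 1) j (by omega) hj
      refine ⟨p k - p j + 2 * π, ⟨by linarith [hkI.1, hjI.2], by linarith⟩,
        ⟨by linarith [hkI.1, hjI.2], by linarith⟩, (hper _).symm, ?_⟩
      rw [← hper (p (k + 1) - p j)]; congr 1; ring
  · intro hgap
    refine h p (N - 1) 0 (2 * π - x (N - 1)) (by grind) (by grind) (by omega)
      (sub_pos.2 hx.2.2) hgap (by rw [← hper (p 0 - p (N - 1)), hzero, hlast]; congr 1; ring)
      (by rw [hzero, hlast]; congr 1; ring) fun j hj hja hjb => ?_
    have hj := Finset.mem_range.1 hj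
    have hj0 := hmono 0 j (by omega) hj
    have hjN := hmono j (N - 1) (by omega) (by omega)
    have hjI := hmem (N - 1) (by omega)
    rw [hzero] at hj0 ⊢
    rw [hlast] at hjN hjI ⊢
    refine ⟨x (N - 1) - p j, ⟨by linarith, by linarith [hjI.2]⟩,
      ⟨by linarith [hjI.2], by linarith⟩, rfl, ?_⟩
    rw [← hper (0 - p j)]; congr 1; ring

/-- For a decreasing coupling function, an orbit of the phase-difference dynamics starting
in the open cone `C` cannot reach the boundary of `C`. -/
theorem orbit_cannot_reach_boundary
    (N : ℕ) (hN : 2 ≤ N) (Γ : ℝ → ℝ) (L₀ L₂π : ℝ)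
    (hper : ∀ θ : ℝ, Γ (θ + 2 * π) = Γ θ)
    (hcont : ContinuousOn Γ (Ioo (0 : ℝ) (2 * π)))
    (hanti : StrictAntiOn Γ (Ioo (0 : ℝ) (2 * π)))
    (hlim0 : Tendsto Γ (𝓝[>] (0 : ℝ)) (𝓝 L₀))
    (hlim2π : Tendsto Γ (𝓝[<] (2 * π)) (𝓝 L₂π))
    (T : ℝ) (hT : 0 < T) (Θ : ℝ → ℕ → ℝ)
    (hΘcont : ∀ k ∈ Finset.Icc 1 (N - 1), ContinuousOn (fun t => Θ t k) (Icc 0 T))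
    (hΘ : IsSolFull N Γ (Ico 0 T) Θ)
    (hΘC : ∀ t ∈ Ico (0 : ℝ) T, inCone N (Θ t)) :
    inCone N (Θ T) := by
  obtain ⟨ε, hε, h⟩ := exists_small_gap_coupling_lt hN hper hcont hanti hlim0 hlim2π
  have hone : 1 ∈ Finset.Icc 1 (N - 1) := by grind
  have hlast : N - 1 ∈ Finset.Icc 1 (N - 1) := by grind
  refine ⟨?_, fun k hk => ?_, ?_⟩
  · refine pos_of_deriv_pos_of_small hT hε (hΘcont 1 hone) (hΘ 1 hone)
      (fun t ht => (hΘC t ht).1) fun t ht hgap => ?_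
    rw [fullRHS_eq_coupling_sub hN Γ _ hone]
    exact sub_pos.2 ((h _ (hΘC t ht)).1 0 (by omega) (by simpa using hgap))
  · have hk₁ : k ∈ Finset.Icc 1 (N - 1) := by grind
    have hk₂ : k + 1 ∈ Finset.Icc 1 (N - 1) := by grind
    have hk0 : k ≠ 0 := by grind
    refine sub_pos.1 (pos_of_deriv_pos_of_small (g := fun t => Θ t (k + 1) - Θ t k) hT hε
      ((hΘcont _ hk₂).sub (hΘcont _ hk₁)) (fun t ht => (hΘ _ hk₂ t ht).sub (hΘ _ hk₁ t ht))
      (fun t ht => sub_pos.2 ((hΘC t ht).2.1 k hk)) fun t ht hgap => ?_)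
    rw [fullRHS_eq_coupling_sub hN Γ _ hk₁, fullRHS_eq_coupling_sub hN Γ _ hk₂,
      sub_sub_sub_cancel_right]
    exact sub_pos.2 ((h _ (hΘC t ht)).1 k (by grind) (by simpa [hk0] using hgap))
  · refine sub_pos.1 (pos_of_deriv_pos_of_small (g := fun t => 2 * π - Θ t (N - 1)) hT hε
      (continuousOn_const.sub (hΘcont _ hlast)) (fun t ht => (hΘ _ hlast t ht).const_sub _)
      (fun t ht => sub_pos.2 (hΘC t ht).2.2) fun t ht hgap => ?_)
    rw [fullRHS_eq_coupling_sub hN Γ _ hlast, neg_sub]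
    exact sub_pos.2 ((h _ (hΘC t ht)).2 hgap)
end
end

section
/- Let N ≥ 2 and let Γ : ℝ → ℝ be 2π-periodic, twice differentiable on (0, 2π), with Γ′(θ) < 0 for every θ ∈ (0, 2π), and with second derivative of constant sign on (0, 2π). Let Θ : [0, ∞) → ℝ^{N−1} be a solution of the phase-difference dynamics with Θ(t) ∈ C for every t ≥ 0. Then Θ(t) converges, as t → +∞, to the splay state θ̃* with θ̃*_k = 2πk/N for k = 1,…,N−1. -/
open Real Filter Set Topology

noncomputable section

/-- If, whenever the largest member of a finite family of differentiable functions touches the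
barrier `B`, its derivative is smaller than that of `B`, then the family stays below `B`. -/
theorem forall_le_barrier {ι : Type*} (S : Finset ι) (f f' : ι → ℝ → ℝ) (B B' : ℝ → ℝ)
    (a b : ℝ)
    (hf : ∀ p ∈ S, ∀ t ∈ Icc a b, HasDerivAt (f p) (f' p t) t)
    (hB : ∀ t ∈ Icc a b, HasDerivAt B (B' t) t)
    (ha : ∀ p ∈ S, f p a ≤ B a)
    (hlt : ∀ t ∈ Ico a b, ∀ p ∈ S, (∀ q ∈ S, f q t ≤ f p t) → f p t = B t → f' p t < B' t) :
    ∀ t ∈ Icc a b, ∀ p ∈ S, f p t ≤ B t := by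
  have hsub : Icc a b ⊆ {t | ∀ p ∈ S, f p t ≤ B t} := by
    refine IsClosed.Icc_subset_of_forall_mem_nhdsWithin ?_ ha ?_
    · have h : {t | ∀ p ∈ S, f p t ≤ B t} ∩ Icc a b
          = Icc a b ∩ ⋂ p ∈ S, {t | t ∈ Icc a b ∧ f p t ≤ B t} := by
        ext t
        simp only [mem_inter_iff, mem_ofPred_eq, mem_iInter]
        exact ⟨fun h => ⟨h.2, fun p hp => ⟨h.2, h.1 p hp⟩⟩, fun h => ⟨fun p hp => (h.2 p hp).2, h.1⟩⟩
      rw [h]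
      refine isClosed_Icc.inter (isClosed_biInter fun p hp => ?_)
      exact isClosed_Icc.isClosed_le
        (fun t ht => (hf p hp t ht).continuousAt.continuousWithinAt)
        (fun t ht => (hB t ht).continuousAt.continuousWithinAt)
    · rintro t ⟨ht, htab⟩
      have htI : t ∈ Icc a b := Ico_subset_Icc_self htab
      change ∀ᶠ u in 𝓝[>] t, ∀ p ∈ S, f p u ≤ B u
      rw [Filter.eventually_all_finset]
      intro p hp
      rcases (ht p hp).lt_or_eq with h | h
      · have h1 := (hf p hp t htI).continuousAt.eventually_lt (hB t htI).continuousAt h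
        exact (h1.filter_mono nhdsWithin_le_nhds).mono fun u hu => hu.le
      · have hneg := hlt t htab p hp (fun q hq => h ▸ ht q hq) h
        have hd : HasDerivWithinAt (fun u => f p u - B u) (f' p t - B' t) (Ioi t) t :=
          ((hf p hp t htI).sub (hB t htI)).hasDerivWithinAt
        have hs := (hasDerivWithinAt_iff_tendsto_slope' (lt_irrefl t)).1 hd
        filter_upwards [hs.eventually_lt_const (sub_neg.2 hneg), self_mem_nhdsWithin] with u hu htu
        have htu' : 0 < u - t := sub_pos.2 htu
        rw [slope_def_field, h, sub_self, sub_zero, div_neg_iff] at hu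
        rcases hu with hu | hu <;> linarith [hu.1, hu.2]
  exact fun t ht => hsub ht

/-- A finite family whose maximum decreases at a definite rate as long as it is at least `ε`
eventually lies below `ε`. -/
theorem eventually_le_of_deriv_argmax_le {ι : Type*} (S : Finset ι) (f f' : ι → ℝ → ℝ)
    {ε η : ℝ} (hη : 0 < η)
    (hf : ∀ p ∈ S, ∀ t, 0 ≤ t → HasDerivAt (f p) (f' p t) t)
    (hmax : ∀ t, 0 ≤ t → ∀ p ∈ S, (∀ q ∈ S, f q t ≤ f p t) → ε ≤ f p t → f' p t ≤ -η) :
    ∀ᶠ t in atTop, ∀ p ∈ S, f p t ≤ ε := by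
  obtain ⟨M, hM⟩ := (S.image fun p => f p 0).exists_le
  have hM' : ∀ p ∈ S, f p 0 ≤ M := fun p hp => hM _ (Finset.mem_image_of_mem _ hp)
  set A := max M ε with hA
  set T := 2 * (A - ε) / η with hT
  have hT0 : 0 ≤ T := by
    have : ε ≤ A := le_max_right _ _
    exact div_nonneg (by linarith) hη.le
  have hTη : η / 2 * T = A - ε := by rw [hT]; field_simp
  have hdown : ∀ p ∈ S, f p T ≤ ε := by
    intro p hp
    have := forall_le_barrier S f f' (fun t => A - η / 2 * t) (fun _ => -(η / 2)) 0 T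
      (fun p hp t ht => hf p hp t ht.1)
      (fun t _ => by simpa using ((hasDerivAt_id t).const_mul (η / 2)).const_sub A)
      (fun p hp => by rw [mul_zero, sub_zero]; exact (hM' p hp).trans (le_max_left _ _))
      (fun t ht p hp hq he => by
        have h1 : η / 2 * t ≤ η / 2 * T := by gcongr; exact ht.2.le
        have := hmax t ht.1 p hp hq (by rw [he]; linarith)
        linarith) T ⟨hT0, le_rfl⟩ p hp
    linarith
  filter_upwards [eventually_ge_atTop T] with t ht
  exact forall_le_barrier S f f' (fun _ => ε) (fun _ => 0) T t
    (fun p hp u hu => hf p hp u (hT0.trans hu.1)) (fun u _ => hasDerivAt_const u ε) hdown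
    (fun u hu p hp hq he => by
      have := hmax u (hT0.trans hu.1) p hp hq he.ge
      linarith) t ⟨ht, le_rfl⟩

/-- Every oscillator of the splay state receives the same total input. -/
theorem sum_coupling_splay_eq (N : ℕ) (hN : 0 < N) (Γ : ℝ → ℝ)
    (hper : ∀ θ : ℝ, Γ (θ + 2 * π) = Γ θ) (k : ℕ) :
    ∑ j ∈ Finset.range N, Γ (2 * π * k / N - 2 * π * j / N)
      = ∑ j ∈ Finset.range N, Γ (2 * π * (0 : ℕ) / N - 2 * π * j / N) := by
  induction k with
  | zero => rfl
  | succ k ih =>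
    rw [← ih]
    obtain ⟨n, rfl⟩ : ∃ n, N = n + 1 := ⟨N - 1, by omega⟩
    rw [Finset.sum_range_succ', Finset.sum_range_succ]
    have hn : ((n + 1 : ℕ) : ℝ) ≠ 0 := by positivity
    congr 1
    · refine Finset.sum_congr rfl fun j _ => ?_
      congr 1
      push_cast
      ring
    · rw [← hper (2 * π * k / (n + 1 : ℕ) - _)]
      congr 1
      push_cast at hn ⊢
      field_simp
      ring

/-- A periodic function that decreases on `(0, 2π)` decreases on `(-2π, 0)`. -/
theorem strictAntiOn_Ioo_neg {Γ : ℝ → ℝ} (hper : ∀ θ : ℝ, Γ (θ + 2 * π) = Γ θ)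
    (hanti : StrictAntiOn Γ (Ioo 0 (2 * π))) : StrictAntiOn Γ (Ioo (-(2 * π)) 0) := by
  intro a ha b hb hab
  rw [← hper a, ← hper b]
  exact hanti ⟨by linarith [ha.1], by linarith [ha.2]⟩ ⟨by linarith [hb.1], by linarith [hb.2]⟩
    (by linarith)

/-- The phases `0 = θ_0, θ_1, …, θ_{N-1}` in the frame of the oscillator `0`. -/
def phase (x : ℕ → ℝ) (k : ℕ) : ℝ := if k = 0 then 0 else x k

theorem phase_lt_phase {N : ℕ} {x : ℕ → ℝ} (hx : inCone N x) {i j : ℕ} (hij : i < j)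
    (hj : j < N) : phase x i < phase x j := by
  have hstep : ∀ k, k + 1 < N → phase x k < phase x (k + 1) := by
    intro k hk
    rcases Nat.eq_zero_or_pos k with rfl | h
    · simpa [phase] using hx.1
    · simpa [phase, h.ne'] using hx.2.1 k (Finset.mem_Icc.2 ⟨h, by omega⟩)
  induction j, hij using Nat.le_induction with
  | base => exact hstep i hj
  | succ j _ ih => exact (ih (by omega)).trans (hstep j hj)

theorem phase_mem_Ico {N : ℕ} (hN : 2 ≤ N) {x : ℕ → ℝ} (hx : inCone N x) {i : ℕ} (hi : i < N) :
    phase x i ∈ Ico 0 (2 * π) := by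
  have h0 : phase x 0 = 0 := by simp [phase]
  have hlast : phase x (N - 1) < 2 * π := by
    simpa [phase, show N - 1 ≠ 0 by omega] using hx.2.2
  constructor
  · rcases Nat.eq_zero_or_pos i with rfl | h
    · exact h0.ge
    · exact h0 ▸ (phase_lt_phase hx h hi).le
  · rcases Nat.lt_or_ge i (N - 1) with h | h
    · exact (phase_lt_phase hx h (by omega)).trans hlast
    · rwa [show i = N - 1 by omega]

theorem phase_sub_mem {N : ℕ} (hN : 2 ≤ N) {x : ℕ → ℝ} (hx : inCone N x) {i j : ℕ} (hij : i < j)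
    (hj : j < N) : phase x j - phase x i ∈ Ioo 0 (2 * π) :=
  ⟨sub_pos.2 (phase_lt_phase hx hij hj),
    by linarith [(phase_mem_Ico hN hx hj).2, (phase_mem_Ico hN hx (hij.trans hj)).1]⟩

theorem fullRHS_eq_sub (N : ℕ) (hN : 0 < N) (Γ : ℝ → ℝ) (x : ℕ → ℝ) {k : ℕ}
    (hk : k ∈ Finset.Icc 1 (N - 1)) :
    fullRHS N Γ x k = ∑ j ∈ Finset.range N, Γ (phase x k - phase x j)
      - ∑ j ∈ Finset.range N, Γ (phase x 0 - phase x j) := by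
  have hr : Finset.range N = insert 0 (Finset.Icc 1 (N - 1)) := by
    ext j
    simp only [Finset.mem_range, Finset.mem_insert, Finset.mem_Icc]
    omega
  have h0 : (0 : ℕ) ∉ Finset.Icc 1 (N - 1) := by simp
  have hph : ∀ j ∈ Finset.Icc 1 (N - 1), phase x j = x j := by
    intro j hj
    have : j ≠ 0 := by have := (Finset.mem_Icc.1 hj).1; omega
    simp [phase, this]
  have hp0 : phase x 0 = 0 := by simp [phase]
  have hsum : ∀ c, ∑ j ∈ Finset.Icc 1 (N - 1), Γ (c - phase x j)
      = ∑ j ∈ Finset.Icc 1 (N - 1), Γ (c - x j) :=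
    fun c => Finset.sum_congr rfl fun j hj => by rw [hph j hj]
  rw [hr, Finset.sum_insert h0, Finset.sum_insert h0, hp0, hph k hk, hsum, hsum,
    ← Finset.add_sum_erase _ (fun j => Γ (x k - x j)) hk, fullRHS]
  simp only [zero_sub, sub_zero, sub_self]
  ring

/-- The splay state lies in the cone. -/
theorem inCone_splay {N : ℕ} (hN : 2 ≤ N) : inCone N fun k => 2 * π * k / N := by
  have hN0 : (0 : ℝ) < N := by exact_mod_cast (by omega : 0 < N)
  have hπ := Real.pi_pos
  refine ⟨by simp only [Nat.cast_one]; positivity, fun k _ => ?_, ?_⟩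
  · push_cast
    gcongr
    linarith
  · simp only
    rw [div_lt_iff₀ hN0]
    gcongr
    omega

theorem phase_splay (N k : ℕ) : phase (fun k => 2 * π * k / N) k = 2 * π * k / N := by
  unfold phase
  split_ifs with h <;> simp [h]

/-- For phases in the cone, the coupling between two oscillators decreases with their phase
difference. -/
theorem coupling_le_of_phase_sub_le {N : ℕ} (hN : 2 ≤ N) {Γ : ℝ → ℝ}
    (hper : ∀ θ : ℝ, Γ (θ + 2 * π) = Γ θ) (hanti : StrictAntiOn Γ (Ioo 0 (2 * π)))
    {x z : ℕ → ℝ} (hx : inCone N x) (hz : inCone N z) {i j : ℕ} (hi : i < N) (hj : j < N)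
    (h : phase z i - phase z j ≤ phase x i - phase x j) :
    Γ (phase x i - phase x j) ≤ Γ (phase z i - phase z j) := by
  rcases lt_trichotomy i j with hij | rfl | hij
  · have h1 := phase_sub_mem hN hx hij hj
    have h2 := phase_sub_mem hN hz hij hj
    exact (strictAntiOn_Ioo_neg hper hanti).antitoneOn
      ⟨by linarith [h2.2], by linarith [h2.1]⟩ ⟨by linarith [h1.2], by linarith [h1.1]⟩ h
  · simp
  · exact hanti.antitoneOn (phase_sub_mem hN hz hij hi) (phase_sub_mem hN hx hij hi) h

/-- A deviation of at least `ε` of a phase difference from `z` lowers the coupling by a definite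
amount, uniformly over the cone. -/
theorem exists_coupling_gap {N : ℕ} (hN : 2 ≤ N) {Γ : ℝ → ℝ}
    (hper : ∀ θ : ℝ, Γ (θ + 2 * π) = Γ θ) (hanti : StrictAntiOn Γ (Ioo 0 (2 * π)))
    {z : ℕ → ℝ} (hz : inCone N z) {ε : ℝ} (hε : 0 < ε) :
    ∃ η > 0, ∀ x, inCone N x → ∀ i < N, ∀ j < N,
      phase z i - phase z j + ε ≤ phase x i - phase x j →
      Γ (phase x i - phase x j) ≤ Γ (phase z i - phase z j) - η := by
  have key : ∀ p ∈ Finset.range N ×ˢ Finset.range N, ∀ᶠ η in 𝓝[>] (0 : ℝ), ∀ x, inCone N x →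
      phase z p.1 - phase z p.2 + ε ≤ phase x p.1 - phase x p.2 →
      Γ (phase x p.1 - phase x p.2) ≤ Γ (phase z p.1 - phase z p.2) - η := by
    have main : ∀ a b u : ℝ, StrictAntiOn Γ (Ioo a b) → u ∈ Ioo a b →
        ∀ᶠ η in 𝓝[>] (0 : ℝ), ∀ v ∈ Ioo a b, u + ε ≤ v → Γ v ≤ Γ u - η := by
      intro a b u hΓ hu
      by_cases hb : u + ε < b
      · have hmem : u + ε ∈ Ioo a b := ⟨by linarith [hu.1], hb⟩
        have hlt : 0 < Γ u - Γ (u + ε) := sub_pos.2 (hΓ hu hmem (by linarith))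
        filter_upwards [Ioo_mem_nhdsGT hlt] with η hη v hv huv
        linarith [hη.2, hΓ.antitoneOn hmem hv huv]
      · exact Eventually.of_forall fun η v hv huv => absurd (huv.trans_lt hv.2) hb
    rintro ⟨i, j⟩ hp
    obtain ⟨hi, hj⟩ := Finset.mem_product.1 hp
    rw [Finset.mem_range] at hi hj
    rcases lt_trichotomy i j with hij | rfl | hij
    · have hz' := phase_sub_mem hN hz hij hj
      filter_upwards [main _ _ (phase z i - phase z j) (strictAntiOn_Ioo_neg hper hanti)
        ⟨by linarith [hz'.2], by linarith [hz'.1]⟩] with η hη x hx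
      have hx' := phase_sub_mem hN hx hij hj
      exact hη _ ⟨by linarith [hx'.2], by linarith [hx'.1]⟩
    · refine Eventually.of_forall fun η x _ h => ?_
      simp only [sub_self] at h
      linarith
    · filter_upwards [main _ _ _ hanti (phase_sub_mem hN hz hij hi)] with η hη x hx
      exact hη _ (phase_sub_mem hN hx hij hi)
  obtain ⟨η, hη, hη0⟩ :=
    (((Filter.eventually_all_finset _).2 key).and self_mem_nhdsWithin).exists
  exact ⟨η, hη0, fun x hx i hi j hj => hη (i, j)
    (Finset.mem_product.2 ⟨Finset.mem_range.2 hi, Finset.mem_range.2 hj⟩) x hx⟩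

/-- For a decreasing monotone coupling function, every orbit of the phase-difference
dynamics that stays in the open cone `C` converges to the splay state `θ̃*_k = 2πk/N`. -/
theorem convergence_to_splay_state
    (N : ℕ) (hN : 2 ≤ N) (Γ Γ' Γ'' : ℝ → ℝ)
    (hper : ∀ θ : ℝ, Γ (θ + 2 * π) = Γ θ)
    (hd1 : ∀ θ ∈ Ioo (0 : ℝ) (2 * π), HasDerivAt Γ (Γ' θ) θ)
    (hd2 : ∀ θ ∈ Ioo (0 : ℝ) (2 * π), HasDerivAt Γ' (Γ'' θ) θ)
    (hmono : ∀ θ ∈ Ioo (0 : ℝ) (2 * π), Γ' θ < 0)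
    (hcurv : (∀ θ ∈ Ioo (0 : ℝ) (2 * π), 0 ≤ Γ'' θ) ∨
      (∀ θ ∈ Ioo (0 : ℝ) (2 * π), Γ'' θ ≤ 0))
    (Θ : ℝ → ℕ → ℝ)
    (hΘ : IsSolFull N Γ (Ici 0) Θ)
    (hΘC : ∀ t ∈ Ici (0 : ℝ), inCone N (Θ t)) :
    ∀ k ∈ Finset.Icc 1 (N - 1),
      Tendsto (fun t => Θ t k) atTop (𝓝 (2 * π * k / N)) := by
  have hanti : StrictAntiOn Γ (Ioo 0 (2 * π)) := by
    refine strictAntiOn_of_deriv_neg (convex_Ioo _ _)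
      (fun θ hθ => (hd1 θ hθ).continuousAt.continuousWithinAt) fun θ hθ => ?_
    rw [interior_Ioo] at hθ
    rw [(hd1 θ hθ).deriv]
    exact hmono θ hθ
  set z : ℕ → ℝ := fun k => 2 * π * k / N with hz_def
  have hz : inCone N z := inCone_splay hN
  set F : (ℕ → ℝ) → ℕ → ℝ := fun x k => ∑ j ∈ Finset.range N, Γ (phase x k - phase x j) with hF
  have hFz : ∀ k, F z k = F z 0 := by
    intro k
    simp only [hF, hz_def, phase_splay]
    exact sum_coupling_splay_eq N (by omega) Γ hper k
  have hder : ∀ k < N, ∀ t, 0 ≤ t →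
      HasDerivAt (fun s => phase (Θ s) k) (F (Θ t) k - F (Θ t) 0) t := by
    intro k hk t ht
    rcases Nat.eq_zero_or_pos k with rfl | h
    · simpa [phase] using hasDerivAt_const t (0 : ℝ)
    · have hk' : k ∈ Finset.Icc 1 (N - 1) := Finset.mem_Icc.2 ⟨h, by omega⟩
      have := hΘ k hk' t ht
      rw [fullRHS_eq_sub N (by omega) Γ _ hk'] at this
      have hp : (fun s => phase (Θ s) k) = fun s => Θ s k := by
        funext s
        simp [phase, h.ne']
      rw [hp]
      exact this
  set S := Finset.range N ×ˢ Finset.range N with hS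
  have hmem : ∀ {i j : ℕ}, i < N → j < N → (i, j) ∈ S := fun hi hj =>
    Finset.mem_product.2 ⟨Finset.mem_range.2 hi, Finset.mem_range.2 hj⟩
  set f : ℕ × ℕ → ℝ → ℝ := fun p t =>
    (phase (Θ t) p.1 - phase z p.1) - (phase (Θ t) p.2 - phase z p.2) with hf
  have hclose : ∀ ε > 0, ∀ᶠ t in atTop, ∀ p ∈ S, f p t ≤ ε := by
    intro ε hε
    obtain ⟨η, hη, hgap⟩ := exists_coupling_gap hN hper hanti hz hε
    refine eventually_le_of_deriv_argmax_le S f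
      (fun p t => (F (Θ t) p.1 - F (Θ t) 0) - (F (Θ t) p.2 - F (Θ t) 0)) hη ?_ ?_
    · intro p hp t ht
      obtain ⟨h1, h2⟩ := Finset.mem_product.1 hp
      exact ((hder _ (Finset.mem_range.1 h1) t ht).sub_const _).sub
        ((hder _ (Finset.mem_range.1 h2) t ht).sub_const _)
    · rintro t ht ⟨i, j⟩ hp hmax hle
      obtain ⟨hi, hj⟩ := Finset.mem_product.1 hp
      rw [Finset.mem_range] at hi hj
      have hx := hΘC t ht
      simp only [hf] at hmax hle
      have hupper : F (Θ t) i ≤ F z i - η := by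
        have hterm : ∀ l ∈ Finset.range N, Γ (phase (Θ t) i - phase (Θ t) l)
            ≤ Γ (phase z i - phase z l) - if l = j then η else 0 := by
          intro l hl
          rw [Finset.mem_range] at hl
          split_ifs with hlj
          · subst hlj
            exact hgap _ hx i hi l hl (by linarith)
          · rw [sub_zero]
            have := hmax (l, j) (hmem hl hj)
            simp only at this
            exact coupling_le_of_phase_sub_le hN hper hanti hx hz hi hl (by linarith)
        have := Finset.sum_le_sum hterm
        rwa [Finset.sum_sub_distrib, Finset.sum_ite_eq' (Finset.range N) j,
          if_pos (Finset.mem_range.2 hj)] at this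
      have hlower : F z j ≤ F (Θ t) j := by
        refine Finset.sum_le_sum fun l hl => ?_
        rw [Finset.mem_range] at hl
        have := hmax (i, l) (hmem hi hl)
        simp only at this
        exact coupling_le_of_phase_sub_le hN hper hanti hz hx hj hl (by linarith)
      have := hFz i
      have := hFz j
      simp only
      linarith
  intro k hk
  obtain ⟨hk1, hk2⟩ := Finset.mem_Icc.1 hk
  have hk0 : k ≠ 0 := by omega
  rw [Metric.tendsto_nhds]
  intro ε hε
  filter_upwards [hclose (ε / 2) (by linarith)] with t ht
  have h1 := ht (k, 0) (hmem (by omega) (by omega))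
  have h2 := ht (0, k) (hmem (by omega) (by omega))
  simp only [hf, hz_def, phase, hk0, if_false, if_true] at h1 h2
  rw [Real.dist_eq, abs_lt]
  constructor <;> linarith
end
end

section
/- Let N ≥ 3 and let Γ : ℝ → ℝ be any function. If (θ̃_2,…,θ̃_{N−1}) : I → ℝ^{N−2} is a solution of the reduced C′₁ dynamics on a set I ⊆ ℝ, then the curve t ↦ (0, θ̃_2(t), …, θ̃_{N−1}(t)) ∈ ℝ^{N−1} is a solution of the full phase-difference dynamics on I; in particular, the synchronized set {θ̃ ∈ ℝ^{N−1} : θ̃_1 = 0} is invariant under the phase-difference dynamics. -/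
open Real Filter Set Topology

noncomputable section

/-- Right-hand side of the reduced `C′₁` dynamics (variables `θ̃_2,…,θ̃_{N-1}`):
`2Γ(x_k) + Σ_{j=2,j≠k}^{N-1} Γ(x_k - x_j) - Σ_{j=2}^{N-1} Γ(-x_j) - Γ(0)`. -/
def redRHS1 (N : ℕ) (Γ : ℝ → ℝ) (x : ℕ → ℝ) (k : ℕ) : ℝ :=
  2 * Γ (x k) + ∑ j ∈ (Finset.Icc 2 (N - 1)).erase k, Γ (x k - x j)
    - ∑ j ∈ Finset.Icc 2 (N - 1), Γ (-(x j)) - Γ 0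

theorem Icc_one_eq_insert_Icc_two {N : ℕ} (hN : 2 ≤ N) :
    Finset.Icc 1 (N - 1) = insert 1 (Finset.Icc 2 (N - 1)) := by
  ext j
  simp only [Finset.mem_Icc, Finset.mem_insert]
  lia

theorem fullRHS_one_eq_zero {N : ℕ} (hN : 2 ≤ N) (Γ : ℝ → ℝ) {y : ℕ → ℝ} (hy : y 1 = 0) :
    fullRHS N Γ y 1 = 0 := by
  have h1 : 1 ∉ Finset.Icc 2 (N - 1) := by simp
  rw [fullRHS, Icc_one_eq_insert_Icc_two hN, Finset.erase_insert h1, Finset.sum_insert h1]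
  simp [hy]

theorem fullRHS_eq_redRHS1 {N k : ℕ} (hN : 2 ≤ N) (hk : k ≠ 1) (Γ : ℝ → ℝ) {y : ℕ → ℝ}
    (hy : y 1 = 0) : fullRHS N Γ y k = redRHS1 N Γ y k := by
  have h1 : 1 ∉ Finset.Icc 2 (N - 1) := by simp
  have h1' : 1 ∉ (Finset.Icc 2 (N - 1)).erase k := by simp
  rw [fullRHS, redRHS1, Icc_one_eq_insert_Icc_two hN, Finset.erase_insert_of_ne hk.symm,
    Finset.sum_insert h1, Finset.sum_insert h1', hy, sub_zero, neg_zero]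
  ring

theorem redRHS1_congr {N k : ℕ} (Γ : ℝ → ℝ) {x y : ℕ → ℝ} (hk : k ≠ 1)
    (hxy : ∀ j, j ≠ 1 → x j = y j) : redRHS1 N Γ x k = redRHS1 N Γ y k := by
  have h : ∀ j ∈ Finset.Icc 2 (N - 1), x j = y j := fun j hj =>
    hxy j (by have := (Finset.mem_Icc.1 hj).1; lia)
  rw [redRHS1, redRHS1, hxy k hk,
    Finset.sum_congr rfl fun j hj => by rw [h j (Finset.mem_of_mem_erase hj)],
    Finset.sum_congr (s₁ := Finset.Icc 2 (N - 1)) rfl fun j hj => by rw [h j hj]]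

/-- A solution of the reduced `C′₁` dynamics, extended by `θ̃₁ = 0`, is a solution of the
full phase-difference dynamics: the synchronized set `{θ̃₁ = 0}` is invariant. -/
theorem reducedC1_solution_extends_to_full_solution
    (N : ℕ) (hN : 3 ≤ N) (Γ : ℝ → ℝ) (I : Set ℝ)
    (x : ℝ → ℕ → ℝ)
    (hx : ∀ k ∈ Finset.Icc 2 (N - 1), ∀ t ∈ I,
      HasDerivAt (fun s => x s k) (redRHS1 N Γ (x t) k) t) :
    IsSolFull N Γ I (fun t k => if k = 1 then 0 else x t k) := by
  have hN2 : 2 ≤ N := by lia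
  intro k hk t ht
  by_cases hk1 : k = 1
  · subst hk1
    rw [fullRHS_one_eq_zero hN2 Γ (if_pos rfl)]
    simpa using hasDerivAt_const t (0 : ℝ)
  · have hk2 : k ∈ Finset.Icc 2 (N - 1) := by
      rw [Finset.mem_Icc] at hk ⊢
      lia
    rw [fullRHS_eq_redRHS1 hN2 hk1 Γ (if_pos rfl),
      redRHS1_congr (y := x t) Γ hk1 fun j hj => if_neg hj]
    simpa only [if_neg hk1] using hx k hk2 t ht
end
end

section
/- Let N ≥ 3, let i ∈ {2,…,N−1}, and let Γ : ℝ → ℝ be any function. If the curves (θ̃_k)_{k ∈ {1,…,N−1}, k ≠ i−1} : I → ℝ form a solution of the reduced C′ᵢ dynamics on a set I ⊆ ℝ, then setting θ̃_{i−1}(t) := θ̃_i(t) for all t ∈ I yields a curve (θ̃_1,…,θ̃_{N−1}) : I → ℝ^{N−1} that is a solution of the full phase-difference dynamics on I; in particular, the synchronized set {θ̃ ∈ ℝ^{N−1} : θ̃_{i−1} = θ̃_i} is invariant under the phase-difference dynamics. -/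
open Real Filter Set Topology

noncomputable section

/-- Splitting two distinct elements off a sum over a finite set. -/
theorem sum_eq_sum_sdiff_pair_add {α M : Type*} [DecidableEq α] [AddCommMonoid M] {s : Finset α}
    {a b : α} (ha : a ∈ s) (hb : b ∈ s) (hab : a ≠ b) (f : α → M) :
    ∑ j ∈ s, f j = ∑ j ∈ s \ {a, b}, f j + (f a + f b) := by
  rw [← Finset.sum_pair hab, Finset.sum_sdiff]
  simp [Finset.insert_subset_iff, ha, hb]

/-- If `g` agrees with `f` off `a` and takes the value `f b` at `a`, then its sum over `s` counts
`f b` twice. -/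
theorem sum_ite_eq_sum_sdiff_pair_add {s : Finset ℕ} {a b : ℕ} (ha : a ∈ s) (hb : b ∈ s)
    (hab : a ≠ b) (x : ℕ → ℝ) (f : ℝ → ℝ) :
    ∑ j ∈ s, f (if j = a then x b else x j) = ∑ j ∈ s \ {a, b}, f (x j) + 2 * f (x b) := by
  rw [sum_eq_sum_sdiff_pair_add ha hb hab, if_pos rfl, if_neg hab.symm, two_mul]
  congr 1
  refine Finset.sum_congr rfl fun j hj => ?_
  rw [if_neg (by rintro rfl; simp at hj)]

/-- A solution of the reduced `C′ᵢ` dynamics, extended by `θ̃_{i-1} = θ̃_i`, is a solution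
of the full phase-difference dynamics: the synchronized set `{θ̃_{i-1} = θ̃_i}` is
invariant. -/
theorem reducedCi_solution_extends_to_full_solution
    (N i : ℕ) (hN : 3 ≤ N) (hi : 2 ≤ i) (hi' : i ≤ N - 1) (Γ : ℝ → ℝ) (I : Set ℝ)
    (x : ℝ → ℕ → ℝ)
    (hx : ∀ k ∈ Finset.Icc 1 (N - 1), k ≠ i - 1 → k ≠ i → ∀ t ∈ I,
      HasDerivAt (fun s => x s k) (redRHSi N i Γ (x t) k) t)
    (hxi : ∀ t ∈ I, HasDerivAt (fun s => x s i) (redRHSii N i Γ (x t)) t) :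
    IsSolFull N Γ I (fun t k => if k = i - 1 then x t i else x t k) := by
  have hne : i - 1 ≠ i := by omega
  have ha : i - 1 ∈ Finset.Icc 1 (N - 1) := Finset.mem_Icc.2 (by omega)
  have hb : i ∈ Finset.Icc 1 (N - 1) := Finset.mem_Icc.2 (by omega)
  intro k hk t ht
  have key : ∀ c, ∑ j ∈ (Finset.Icc 1 (N - 1)).erase k,
      Γ (c - if j = i - 1 then x t i else x t j) =
      ∑ j ∈ Finset.Icc 1 (N - 1), Γ (c - if j = i - 1 then x t i else x t j) -
        Γ (c - if k = i - 1 then x t i else x t k) := fun c =>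
    Finset.sum_erase_eq_sub hk
  have hsum := fun f => sum_ite_eq_sum_sdiff_pair_add ha hb hne (x t) f
  have hneg := hsum fun y => Γ (-y)
  have hsub := fun c => hsum fun y => Γ (c - y)
  beta_reduce at hneg hsub
  by_cases hki : k = i - 1 ∨ k = i
  · have hval : ∀ s, (if k = i - 1 then x s i else x s k) = x s i := by
      rcases hki with rfl | rfl <;> simp
    simp only [fullRHS, key, hval, hneg, hsub]
    convert hxi t ht using 1
    rw [redRHSii, sub_self]
    ring
  · push Not at hki
    have hsplit : (Finset.Icc 1 (N - 1)) \ {k, i - 1, i} =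
        (Finset.Icc 1 (N - 1) \ {i - 1, i}).erase k := by
      ext j
      simp only [Finset.mem_sdiff, Finset.mem_insert, Finset.mem_singleton, Finset.mem_erase]
      tauto
    have hmem : k ∈ Finset.Icc 1 (N - 1) \ {i - 1, i} := by
      simp only [Finset.mem_sdiff, Finset.mem_insert, Finset.mem_singleton]
      tauto
    simp only [fullRHS, key, if_neg hki.1, hneg, hsub]
    convert hx k hk hki.1 hki.2 t ht using 1
    rw [redRHSi, hsplit, Finset.sum_erase_eq_sub hmem]
    ring
end
end
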